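/- arXiv:math/0602426 — 11 statements merged into one kernel-verified Lean document; each statement's English description precedes it below -/
import Mathlib

section
/- Let f : (0,∞) → [0,∞) be locally integrable and assume that for every s > 0 the set {x ∈ (0,∞) : Sf(x) > s} has finite Lebesgue measure. Then for every t > 0, λ_{Sf}(t) = (1/t) · ∫_{{x : Sf(x) > t}} f(x) dx. -/
open MeasureTheory Set
open scoped ENNReal

/-- The Hardy operator `S f (x) = (1/x) ∫₀ˣ f(y) dy`. -/
noncomputable def S (f : ℝ → ℝ) (x : ℝ) : ℝ := (1 / x) * ∫ y in Ioo (0 : ℝ) x, f y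

/-- The distribution function `λ_g(s) = |{x ∈ (0,∞) : |g(x)| > s}|`. -/
noncomputable def distFn (g : ℝ → ℝ) (s : ℝ) : ℝ≥0∞ :=
  volume {x | x ∈ Ioi (0 : ℝ) ∧ s < |g x|}

/-- Two measures agree on an open set `U` of finite length as soon as they agree on every
bounded open interval contained in `U` whose endpoints do not belong to `U`. -/
theorem measure_eq_of_forall_maximal_Ioo {U : Set ℝ} (hU : IsOpen U) (hvol : volume U ≠ ⊤)
    (hbdd : BddBelow U) (μ ν : Measure ℝ)
    (h : ∀ a b, a < b → Ioo a b ⊆ U → a ∉ U → b ∉ U → μ (Ioo a b) = ν (Ioo a b)) :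
    μ U = ν U := by
  set C : Set (Set ℝ) := connectedComponentIn U '' U
  have hopen : ∀ I ∈ C, IsOpen I := by
    rintro _ ⟨x, -, rfl⟩
    exact hU.connectedComponentIn
  have hdisj : C.Pairwise Disjoint := by
    rintro _ ⟨x, hx, rfl⟩ _ ⟨y, hy, rfl⟩ hne
    rw [Set.disjoint_left]
    intro z hz hz'
    exact hne ((connectedComponentIn_eq hz).trans (connectedComponentIn_eq hz').symm)
  have hcount : C.Countable := by
    refine Set.PairwiseDisjoint.countable_of_isOpen (s := id) hdisj hopen ?_
    rintro _ ⟨x, hx, rfl⟩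
    exact ⟨x, mem_connectedComponentIn hx⟩
  have hUC : U = ⋃₀ C := by
    refine Subset.antisymm (fun x hx => ⟨_, ⟨x, hx, rfl⟩, mem_connectedComponentIn hx⟩) ?_
    rintro y ⟨_, ⟨x, hx, rfl⟩, hy⟩
    exact connectedComponentIn_subset U x hy
  rw [hUC, measure_sUnion hcount hdisj fun I hI => (hopen I hI).measurableSet,
    measure_sUnion hcount hdisj fun I hI => (hopen I hI).measurableSet]
  refine tsum_congr ?_
  rintro ⟨I, hI⟩
  obtain ⟨x, hx, hxI⟩ := hI
  change μ I = ν I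
  have hIopen : IsOpen I := hopen I ⟨x, hx, hxI⟩
  have hIU : I ⊆ U := hxI ▸ connectedComponentIn_subset U x
  have hne : I.Nonempty := ⟨x, hxI ▸ mem_connectedComponentIn hx⟩
  have hconn : IsConnected I := hxI ▸ isConnected_connectedComponentIn_iff.2 hx
  have hclosure : ∀ a ∈ closure I, a ∈ U → a ∈ I := by
    intro a ha haU
    obtain ⟨y, hya, hyI⟩ := mem_closure_iff.1 ha _ (hU.connectedComponentIn (x := a))
      (mem_connectedComponentIn haU)
    rw [← hxI] at hyI
    rw [← hxI, connectedComponentIn_eq hyI, ← connectedComponentIn_eq hya]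
    exact mem_connectedComponentIn haU
  have hbelow : BddBelow I := hbdd.mono hIU
  have habove : BddAbove I := by
    by_contra hb
    have := measure_mono (μ := volume) ((hconn.isPreconnected.Ioi_csInf_subset hbelow hb).trans hIU)
    rw [Real.volume_Ioi, top_le_iff] at this
    exact hvol this
  have hinf : sInf I ∉ I := fun hm => by
    obtain ⟨y, hy, hyI⟩ := (Filter.Eventually.and (f := nhdsWithin (sInf I) (Iio (sInf I)))
      (mem_nhdsWithin_of_mem_nhds (hIopen.mem_nhds hm)) self_mem_nhdsWithin).exists
    exact (csInf_le hbelow hy).not_gt hyI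
  have hsup : sSup I ∉ I := fun hm => by
    obtain ⟨y, hy, hyI⟩ := (Filter.Eventually.and (f := nhdsWithin (sSup I) (Ioi (sSup I)))
      (mem_nhdsWithin_of_mem_nhds (hIopen.mem_nhds hm)) self_mem_nhdsWithin).exists
    exact (le_csSup habove hy).not_gt hyI
  have hIeq : I = Ioo (sInf I) (sSup I) := by
    refine Subset.antisymm (fun y hy => ⟨?_, ?_⟩) (hconn.Ioo_csInf_csSup_subset hbelow habove)
    · exact (csInf_le hbelow hy).lt_of_ne fun e => hinf (e ▸ hy)
    · exact (le_csSup habove hy).lt_of_ne fun e => hsup (e ▸ hy)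
  have hlt : sInf I < sSup I := by
    obtain ⟨y, hy⟩ := hne
    rw [hIeq] at hy
    exact hy.1.trans hy.2
  rw [hIeq]
  exact h _ _ hlt (hIeq ▸ hIU) (fun hm => hinf (hclosure _ (csInf_mem_closure hne hbelow) hm))
    (fun hm => hsup (hclosure _ (csSup_mem_closure hne habove) hm))

/-- If a continuous function exceeds `t * x` exactly on `U ⊆ (0, ∞)` and vanishes at `0`, then its
increment over a maximal interval of `U` is `t` times the length of that interval. -/
theorem sub_eq_mul_of_maximal_Ioo {F : ℝ → ℝ} (hF : Continuous F) (hF0 : F 0 = 0) {t a b : ℝ}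
    (hab : a < b) (hsub : Ioo a b ⊆ {x | 0 < x ∧ t * x < F x})
    (ha : a ∉ {x | 0 < x ∧ t * x < F x}) (hb : b ∉ {x | 0 < x ∧ t * x < F x}) :
    F b - F a = t * (b - a) := by
  have hle : Icc a b ⊆ {x | 0 ≤ x ∧ t * x ≤ F x} := by
    rw [← closure_Ioo hab.ne]
    refine closure_minimal (fun x hx => ⟨(hsub hx).1.le, (hsub hx).2.le⟩) ?_
    exact (isClosed_le continuous_const continuous_id).inter
      (isClosed_le (by fun_prop) hF)
  have hend : ∀ x, 0 ≤ x ∧ t * x ≤ F x → x ∉ {x | 0 < x ∧ t * x < F x} → F x = t * x := by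
    rintro x ⟨hx0, hx⟩ hxU
    rcases hx0.eq_or_lt with rfl | hpos
    · simpa using hF0
    · exact le_antisymm (not_lt.1 fun h => hxU ⟨hpos, h⟩) hx
  rw [hend a (hle (left_mem_Icc.2 hab.le)) ha, hend b (hle (right_mem_Icc.2 hab.le)) hb]
  ring

/-- If `f : (0,∞) → [0,∞)` is locally integrable and all the level sets of `S f` have finite
measure, then `λ_{Sf}(t) = (1/t) ∫_{{Sf > t}} f`. -/
theorem distribution_of_hardy_eq (f : ℝ → ℝ) (hmeas : Measurable f)
    (hnn : ∀ x ∈ Ioi (0 : ℝ), 0 ≤ f x)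
    (hloc : ∀ x > (0 : ℝ), IntegrableOn f (Ioo 0 x))
    (hfin : ∀ s > (0 : ℝ), distFn (S f) s < ⊤) :
    ∀ t > (0 : ℝ),
      distFn (S f) t =
        ENNReal.ofReal ((1 / t) * ∫ x in {x | x ∈ Ioi (0 : ℝ) ∧ t < S f x}, f x) := by
  intro t ht
  set g : ℝ → ℝ := (Ioi (0 : ℝ)).indicator f with hg
  have hint : ∀ a b, IntervalIntegrable g volume a b := by
    intro a b
    set c := max 1 (max a b)
    have hc : 0 < c := zero_lt_one.trans_le (le_max_left _ _)
    have h1 : IntegrableOn g (Iic c) := by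
      rw [hg, IntegrableOn, integrable_indicator_iff measurableSet_Ioi, IntegrableOn,
        Measure.restrict_restrict measurableSet_Ioi, Ioi_inter_Iic]
      exact (integrableOn_Ioc_iff_integrableOn_Ioo enorm_ne_top).2 (hloc c hc)
    refine (intervalIntegrable_iff).2 (h1.mono_set fun x hx => hx.2.trans (le_max_right _ _))
  set F : ℝ → ℝ := fun x => ∫ y in (0 : ℝ)..x, g y with hFdef
  have hF : Continuous F := intervalIntegral.continuous_primitive hint 0
  have hF0 : F 0 = 0 := intervalIntegral.integral_same
  have hg0 : ∀ x, 0 ≤ g x := fun x => indicator_nonneg hnn x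
  have hgm : Measurable g := hmeas.indicator measurableSet_Ioi
  have hS : ∀ x, 0 < x → S f x = F x / x := by
    intro x hx
    rw [S, hFdef]
    simp only
    rw [intervalIntegral.integral_of_le hx.le, integral_Ioc_eq_integral_Ioo,
      setIntegral_congr_fun measurableSet_Ioo
        (fun y hy => (indicator_of_mem (s := Ioi (0 : ℝ)) hy.1 f).symm)]
    ring
  have hSnn : ∀ x, 0 < x → 0 ≤ S f x := fun x hx => by
    rw [hS x hx]
    exact div_nonneg (intervalIntegral.integral_nonneg_of_forall hx.le hg0) hx.le
  set U : Set ℝ := {x | 0 < x ∧ t * x < F x}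
  have hUS : {x | x ∈ Ioi (0 : ℝ) ∧ t < S f x} = U := by
    ext x
    refine and_congr_right fun hx => ?_
    rw [hS x hx, lt_div_iff₀ hx]
  have hdist : distFn (S f) t = volume U := by
    rw [distFn, ← hUS]
    congr 1
    ext x
    refine and_congr_right fun hx => ?_
    rw [abs_of_nonneg (hSnn x hx)]
  have hvol : volume U ≠ ⊤ := hdist ▸ (hfin t ht).ne
  have hUopen : IsOpen U :=
    (isOpen_lt continuous_const continuous_id).inter (isOpen_lt (by fun_prop) hF)
  have key : volume.withDensity (fun x => ENNReal.ofReal (g x)) U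
      = (ENNReal.ofReal t • (volume : Measure ℝ)) U := by
    refine measure_eq_of_forall_maximal_Ioo hUopen hvol ⟨0, fun x hx => hx.1.le⟩ _ _ ?_
    intro a b hab hsub ha hb
    have hinc := sub_eq_mul_of_maximal_Ioo hF hF0 hab hsub ha hb
    rw [hFdef] at hinc
    simp only at hinc
    rw [intervalIntegral.integral_interval_sub_left (hint _ _) (hint _ _),
      intervalIntegral.integral_of_le hab.le, integral_Ioc_eq_integral_Ioo] at hinc
    rw [withDensity_apply _ measurableSet_Ioo, ← ofReal_integral_eq_lintegral_ofReal
      (((intervalIntegrable_iff_integrableOn_Ioo_of_le hab.le).1 (hint a b)))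
      (Filter.Eventually.of_forall hg0), hinc, ENNReal.ofReal_mul ht.le]
    simp
  rw [withDensity_apply _ hUopen.measurableSet, Measure.smul_apply, smul_eq_mul] at key
  rw [hdist, hUS, setIntegral_congr_fun hUopen.measurableSet
    (fun y hy => (indicator_of_mem (s := Ioi (0 : ℝ)) hy.1 f).symm),
    integral_eq_lintegral_of_nonneg_ae (Filter.Eventually.of_forall hg0)
      hgm.aestronglyMeasurable, key, ENNReal.toReal_mul, ENNReal.toReal_ofReal ht.le, ← mul_assoc,
    one_div, inv_mul_cancel₀ ht.ne', one_mul, ENNReal.ofReal_toReal hvol]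
end

section
/- Let f : (0,∞) → [0,∞) be measurable and locally integrable. Then sup_{s>0} s·λ_{Sf}(s) = ∫₀^∞ f(x) dx, as an equality in [0,∞]. In particular, Sf belongs to weak-L¹ (i.e. ‖Sf‖_{L^{1,∞}} := sup_{s>0} s·λ_{Sf}(s) < ∞) if and only if f ∈ L¹(0,∞), and in that case ‖Sf‖_{L^{1,∞}} = ‖f‖_{L¹}. (This expresses the identity [S, L^{1,∞}(ℝ⁺)] = L¹(ℝ⁺) with equality of norms.) -/
open MeasureTheory Set
open scoped ENNReal

lemma ofReal_setIntegral_Ioo {f : ℝ → ℝ} (hnn : ∀ x ∈ Ioi (0 : ℝ), 0 ≤ f x)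
    {x : ℝ} (hf : IntegrableOn f (Ioo 0 x)) :
    ENNReal.ofReal (∫ y in Ioo (0 : ℝ) x, f y) = ∫⁻ y in Ioo (0 : ℝ) x, ENNReal.ofReal (f y) :=
  ofReal_integral_eq_lintegral_ofReal hf <|
    (ae_restrict_mem measurableSet_Ioo).mono fun y hy => hnn y hy.1

lemma setIntegral_Ioo_nonneg {f : ℝ → ℝ} (hnn : ∀ x ∈ Ioi (0 : ℝ), 0 ≤ f x) (x : ℝ) :
    0 ≤ ∫ y in Ioo (0 : ℝ) x, f y :=
  setIntegral_nonneg measurableSet_Ioo fun y hy => hnn y hy.1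

lemma lt_abs_S_iff {f : ℝ → ℝ} (hnn : ∀ x ∈ Ioi (0 : ℝ), 0 ≤ f x) {s x : ℝ} (hx : 0 < x) :
    s < |S f x| ↔ s * x < ∫ y in Ioo (0 : ℝ) x, f y := by
  have h := setIntegral_Ioo_nonneg hnn x
  rw [S, abs_of_nonneg (by positivity), one_div_mul_eq_div, lt_div_iff₀ hx]

lemma ofReal_mul_distFn_S_le {f : ℝ → ℝ} (hnn : ∀ x ∈ Ioi (0 : ℝ), 0 ≤ f x)
    (hloc : ∀ x > (0 : ℝ), IntegrableOn f (Ioo 0 x)) {s : ℝ} (hs : 0 < s) :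
    ENNReal.ofReal s * distFn (S f) s ≤ ∫⁻ x in Ioi (0 : ℝ), ENNReal.ofReal (f x) := by
  rcases eq_or_ne (∫⁻ x in Ioi (0 : ℝ), ENNReal.ofReal (f x)) ⊤ with htop | htop
  · exact htop ▸ le_top
  set I := ∫⁻ x in Ioi (0 : ℝ), ENNReal.ofReal (f x)
  have hsub : {x | x ∈ Ioi (0 : ℝ) ∧ s < |S f x|} ⊆ Ioo 0 (I.toReal / s) := by
    rintro x ⟨hx, hlt⟩
    rw [lt_abs_S_iff hnn hx] at hlt
    refine ⟨hx, ?_⟩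
    rw [lt_div_iff₀ hs, mul_comm]
    refine hlt.trans_le ?_
    rw [← ENNReal.ofReal_le_iff_le_toReal htop, ofReal_setIntegral_Ioo hnn (hloc x hx)]
    exact lintegral_mono_set Ioo_subset_Ioi_self
  calc ENNReal.ofReal s * distFn (S f) s
      ≤ ENNReal.ofReal s * volume (Ioo 0 (I.toReal / s)) := by
        gcongr
        exact measure_mono hsub
    _ = I := by
        rw [Real.volume_Ioo, ← ENNReal.ofReal_mul hs.le, sub_zero, mul_div_cancel₀ _ hs.ne',
          ENNReal.ofReal_toReal htop]

lemma ofReal_sub_le_ofReal_mul_distFn_S {f : ℝ → ℝ} (hnn : ∀ x ∈ Ioi (0 : ℝ), 0 ≤ f x)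
    (hloc : ∀ x > (0 : ℝ), IntegrableOn f (Ioo 0 x)) {s a : ℝ} (hs : 0 < s) (ha : 0 < a) :
    ENNReal.ofReal ((∫ y in Ioo (0 : ℝ) a, f y) - s * a) ≤ ENNReal.ofReal s * distFn (S f) s := by
  set A := ∫ y in Ioo (0 : ℝ) a, f y
  have hsub : Ico a (A / s) ⊆ {x | x ∈ Ioi (0 : ℝ) ∧ s < |S f x|} := by
    rintro x ⟨hax, hxA⟩
    have hx : 0 < x := ha.trans_le hax
    refine ⟨hx, (lt_abs_S_iff hnn hx).2 ?_⟩
    rw [lt_div_iff₀ hs, mul_comm] at hxA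
    refine hxA.trans_le (setIntegral_mono_set (hloc x hx) ?_ (Ioo_subset_Ioo_right hax).eventuallyLE)
    exact (ae_restrict_mem measurableSet_Ioo).mono fun y hy => hnn y hy.1
  calc ENNReal.ofReal (A - s * a)
      = ENNReal.ofReal s * volume (Ico a (A / s)) := by
        rw [Real.volume_Ico, ← ENNReal.ofReal_mul hs.le, mul_sub, mul_div_cancel₀ _ hs.ne']
    _ ≤ ENNReal.ofReal s * distFn (S f) s := by
        gcongr
        exact measure_mono hsub

lemma lintegral_Ioi_eq_iSup_Ioo (g : ℝ → ℝ≥0∞) :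
    ∫⁻ x in Ioi (0 : ℝ), g x = ⨆ n : ℕ, ∫⁻ x in Ioo (0 : ℝ) (n + 1), g x := by
  have hU : Ioi (0 : ℝ) = ⋃ n : ℕ, Ioo (0 : ℝ) (n + 1) := by
    ext x
    simp only [mem_Ioi, mem_iUnion, mem_Ioo, exists_and_left, iff_self_and]
    intro
    obtain ⟨n, hn⟩ := exists_nat_gt x
    exact ⟨n, by linarith⟩
  have hmono : Monotone fun n : ℕ => Ioo (0 : ℝ) (n + 1) := fun m n hmn =>
    Ioo_subset_Ioo_right (by gcongr)
  rw [hU, setLIntegral_iUnion_of_directed _ hmono.directed_le]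

/-- For `f : (0,∞) → [0,∞)` measurable and locally integrable,
`sup_{s>0} s·λ_{Sf}(s) = ∫₀^∞ f`, as an equality in `[0,∞]`.  In particular
`‖Sf‖_{L^{1,∞}} < ∞` iff `f ∈ L¹(0,∞)`, with equality of norms:
`[S, L^{1,∞}(ℝ⁺)] = L¹(ℝ⁺)`. -/
theorem hardy_weakL1_norm_eq_L1_norm (f : ℝ → ℝ) (hmeas : Measurable f)
    (hnn : ∀ x ∈ Ioi (0 : ℝ), 0 ≤ f x)
    (hloc : ∀ x > (0 : ℝ), IntegrableOn f (Ioo 0 x)) :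
    ((⨆ s ∈ Ioi (0 : ℝ), ENNReal.ofReal s * distFn (S f) s)
        = ∫⁻ x in Ioi (0 : ℝ), ENNReal.ofReal (f x)) ∧
    ((⨆ s ∈ Ioi (0 : ℝ), ENNReal.ofReal s * distFn (S f) s) < ⊤ ↔
        IntegrableOn f (Ioi 0)) := by
  have heq : (⨆ s ∈ Ioi (0 : ℝ), ENNReal.ofReal s * distFn (S f) s)
      = ∫⁻ x in Ioi (0 : ℝ), ENNReal.ofReal (f x) := by
    refine le_antisymm (iSup₂_le fun s hs => ofReal_mul_distFn_S_le hnn hloc hs) ?_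
    rw [lintegral_Ioi_eq_iSup_Ioo]
    refine iSup_le fun n => ?_
    have ha : (0 : ℝ) < n + 1 := by positivity
    rw [← ofReal_setIntegral_Ioo hnn (hloc _ ha)]
    have hcont : Continuous fun s : ℝ =>
        ENNReal.ofReal ((∫ y in Ioo (0 : ℝ) (n + 1), f y) - s * (n + 1)) :=
      ENNReal.continuous_ofReal.comp (by fun_prop)
    have hlim := (hcont.tendsto 0).mono_left (nhdsWithin_le_nhds (s := Ioi 0))
    rw [zero_mul, sub_zero] at hlim
    refine le_of_tendsto hlim (eventually_mem_nhdsWithin.mono fun s hs => ?_)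
    exact (ofReal_sub_le_ofReal_mul_distFn_S hnn hloc hs ha).trans
      (le_iSup₂ (f := fun s (_ : s ∈ Ioi (0 : ℝ)) => ENNReal.ofReal s * distFn (S f) s) s hs)
  refine ⟨heq, ?_⟩
  rw [heq, ← hasFiniteIntegral_iff_ofReal
    ((ae_restrict_mem measurableSet_Ioi).mono fun x hx => hnn x hx)]
  exact ⟨fun h => ⟨hmeas.aestronglyMeasurable, h⟩, fun h => h.2⟩
end

section
/- Let f : (0,∞) → [0,∞) be locally integrable. If Sf is integrable on (0,∞), then f = 0 almost everywhere. (In other words, the optimal domain [S, L¹(ℝ⁺)] = {f : S|f| ∈ L¹} is the trivial space {0}.) -/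
open MeasureTheory Set
open scoped ENNReal

/-- If `S f` is integrable on `(0,∞)`, then a nonnegative `f` has zero mass on `(0,a)`, because
`S f` dominates a multiple of `1/x` on `(a,∞)`. -/
lemma setIntegral_Ioo_eq_zero_of_integrableOn_S {f : ℝ → ℝ}
    (hnn : ∀ x ∈ Ioi (0 : ℝ), 0 ≤ f x)
    (hloc : ∀ x > (0 : ℝ), IntegrableOn f (Ioo 0 x))
    (hS : IntegrableOn (S f) (Ioi 0)) {a : ℝ} (ha : 0 < a) :
    ∫ y in Ioo (0 : ℝ) a, f y = 0 := by
  set c := ∫ y in Ioo (0 : ℝ) a, f y with hc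
  have hc0 : 0 ≤ c := setIntegral_nonneg measurableSet_Ioo fun x hx => hnn x hx.1
  by_contra hne
  have hdom : IntegrableOn (fun x : ℝ => c * x⁻¹) (Ioi a) := by
    refine (hS.mono_set (Ioi_subset_Ioi ha.le)).mono' (by fun_prop) ?_
    filter_upwards [ae_restrict_mem measurableSet_Ioi] with x hx
    have hx0 : 0 < x := ha.trans hx
    have hle : c ≤ ∫ y in Ioo (0 : ℝ) x, f y := by
      refine setIntegral_mono_set (hloc x hx0) ?_ (Ioo_subset_Ioo_right (le_of_lt hx)).eventuallyLE
      filter_upwards [ae_restrict_mem measurableSet_Ioo] with y hy using hnn y hy.1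
    rw [Real.norm_of_nonneg (by positivity), S, one_div, mul_comm]
    gcongr
  refine not_integrableOn_Ioi_inv (a := a) ?_
  simpa [IntegrableOn, ← mul_assoc, inv_mul_cancel₀ hne] using hdom.const_mul c⁻¹

/-- If `f : (0,∞) → [0,∞)` is locally integrable and `S f` is integrable on `(0,∞)`, then
`f = 0` a.e.: the optimal domain `[S, L¹(ℝ⁺)]` is the trivial space `{0}`. -/
theorem hardy_L1_domain_trivial (f : ℝ → ℝ) (hmeas : Measurable f)
    (hnn : ∀ x ∈ Ioi (0 : ℝ), 0 ≤ f x)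
    (hloc : ∀ x > (0 : ℝ), IntegrableOn f (Ioo 0 x))
    (hS : IntegrableOn (S f) (Ioi 0)) :
    ∀ᵐ x ∂(volume.restrict (Ioi (0 : ℝ))), f x = 0 := by
  have hU : Ioi (0 : ℝ) = ⋃ n : ℕ, Ioo (0 : ℝ) (n + 1) := by
    ext x
    simp only [mem_Ioi, mem_iUnion, mem_Ioo, exists_and_left, iff_self_and]
    intro _
    obtain ⟨n, hn⟩ := exists_nat_gt x
    exact ⟨n, by linarith⟩
  rw [hU, ae_restrict_iUnion_iff]
  intro n
  have hn : (0 : ℝ) < n + 1 := by positivity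
  refine (setIntegral_eq_zero_iff_of_nonneg_ae ?_ (hloc _ hn)).1
    (setIntegral_Ioo_eq_zero_of_integrableOn_S hnn hloc hS hn)
  filter_upwards [ae_restrict_mem measurableSet_Ioo] with y hy using hnn y hy.1
end

section
/- Define g(t) = 1/(t·log²(e²/t)) for t ∈ (0,1) and g(t) = 0 otherwise, and define f(t) = g(t−1) for t ∈ (1,2) and f(t) = 0 otherwise. Then: (i) f and g have the same distribution function (they are equimeasurable, and g is the decreasing rearrangement of f); (ii) Sf ∈ L^∞(0,∞), so in particular Sf ∈ L¹+L^∞; (iii) Sg does NOT belong to L¹+L^∞. Consequently, the Hardy operator S is not bounded on L¹+L^∞, and the optimal domain [S, L¹+L^∞] is not rearrangement invariant. -/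
open MeasureTheory Set
open scoped ENNReal

/-- `f` belongs to `L¹ + L^∞` on `(0,∞)`. -/
def InL1PlusLinfty (f : ℝ → ℝ) : Prop :=
  ∃ g₁ g₂ : ℝ → ℝ, IntegrableOn g₁ (Ioi 0) ∧
    (∃ C : ℝ, ∀ᵐ x ∂(volume.restrict (Ioi (0 : ℝ))), |g₂ x| ≤ C) ∧
    (∀ᵐ x ∂(volume.restrict (Ioi (0 : ℝ))), f x = g₁ x + g₂ x)

/-- `g(t) = 1/(t·log²(e²/t))` on `(0,1)`, `0` otherwise. -/
noncomputable def gex : ℝ → ℝ :=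
  (Ioo (0 : ℝ) 1).indicator fun t => 1 / (t * (Real.log (Real.exp 2 / t)) ^ 2)

/-- `f(t) = g(t-1)` on `(1,2)`, `0` otherwise. -/
noncomputable def fex : ℝ → ℝ := fun t => gex (t - 1)

open Filter Topology

lemma log_exp_two_div {t : ℝ} (ht : 0 < t) : Real.log (Real.exp 2 / t) = 2 - Real.log t := by
  rw [Real.log_div (Real.exp_ne_zero 2) ht.ne', Real.log_exp]

lemma gex_of_mem {t : ℝ} (ht : t ∈ Ioo (0 : ℝ) 1) : gex t = 1 / (t * (2 - Real.log t) ^ 2) := by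
  rw [gex, indicator_of_mem ht, log_exp_two_div ht.1]

lemma gex_of_notMem {t : ℝ} (ht : t ∉ Ioo (0 : ℝ) 1) : gex t = 0 :=
  indicator_of_notMem ht _

lemma two_sub_log_pos {t : ℝ} (ht : t ∈ Ioo (0 : ℝ) 1) : 0 < 2 - Real.log t := by
  linarith [Real.log_neg ht.1 ht.2]

lemma gex_nonneg (t : ℝ) : 0 ≤ gex t := by
  by_cases ht : t ∈ Ioo (0 : ℝ) 1
  · rw [gex_of_mem ht]
    have := ht.1
    positivity
  · rw [gex_of_notMem ht]

lemma tendsto_two_sub_log_nhdsGT_zero :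
    Tendsto (fun t : ℝ => 2 - Real.log t) (𝓝[>] 0) atTop := by
  simpa [sub_eq_add_neg] using
    tendsto_atTop_add_const_left _ 2 (tendsto_neg_atBot_atTop.comp Real.tendsto_log_nhdsGT_zero)

/-- The continuous extension to `0` of `t ↦ 1 / (2 - log t)`, a primitive of `gex` on `[0, 1]`. -/
noncomputable def gexPrimitive : ℝ → ℝ :=
  Function.update (fun t => (2 - Real.log t)⁻¹) 0 0

lemma gexPrimitive_of_ne {t : ℝ} (ht : t ≠ 0) : gexPrimitive t = (2 - Real.log t)⁻¹ :=
  Function.update_of_ne ht _ _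

lemma gexPrimitive_zero : gexPrimitive 0 = 0 :=
  Function.update_self _ _ _

lemma continuousOn_gexPrimitive : ContinuousOn gexPrimitive (Icc 0 1) := by
  rw [gexPrimitive, continuousOn_update_iff]
  refine ⟨fun t ht => ContinuousAt.continuousWithinAt ?_, fun _ => ?_⟩
  · have h0 : t ≠ 0 := ht.2
    have h1 : Real.log t ≤ 0 := Real.log_nonpos ht.1.1 ht.1.2
    exact (continuousAt_const.sub (Real.continuousAt_log h0)).inv₀
      (show 2 - Real.log t ≠ 0 by linarith)
  · rw [Icc_sdiff_left]
    exact tendsto_two_sub_log_nhdsGT_zero.inv_tendsto_atTop.mono_left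
      (nhdsWithin_mono _ fun _ hx => hx.1)

lemma hasDerivAt_gexPrimitive {t : ℝ} (ht : t ∈ Ioo (0 : ℝ) 1) :
    HasDerivAt gexPrimitive (gex t) t := by
  have h := ((Real.hasDerivAt_log ht.1.ne').const_sub 2).inv (two_sub_log_pos ht).ne'
  have heq : gexPrimitive =ᶠ[𝓝 t] (fun t => 2 - Real.log t)⁻¹ := by
    filter_upwards [isOpen_ne.mem_nhds ht.1.ne'] with y hy
    exact gexPrimitive_of_ne hy
  refine (h.congr_of_eventuallyEq heq).congr_deriv ?_
  rw [gex_of_mem ht]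
  have h0 := ht.1.ne'
  have h1 := (two_sub_log_pos ht).ne'
  field_simp

lemma integrableOn_gex_Ioc : IntegrableOn gex (Ioc 0 1) :=
  intervalIntegral.integrableOn_deriv_of_nonneg continuousOn_gexPrimitive
    (fun _ => hasDerivAt_gexPrimitive) fun t _ => gex_nonneg t

lemma integrable_gex : Integrable gex := by
  refine (integrableOn_iff_integrable_of_support_subset fun t ht => ?_).1 integrableOn_gex_Ioc
  by_contra h
  exact ht (gex_of_notMem fun h' => h ⟨h'.1, h'.2.le⟩)

lemma S_gex_of_mem {x : ℝ} (hx : x ∈ Ioo (0 : ℝ) 1) :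
    S gex x = 1 / x * (2 - Real.log x)⁻¹ := by
  rw [S, ← integral_Ioc_eq_integral_Ioo, ← intervalIntegral.integral_of_le hx.1.le,
    intervalIntegral.integral_eq_sub_of_hasDerivAt_of_le hx.1.le
      (continuousOn_gexPrimitive.mono (Icc_subset_Icc_right hx.2.le))
      (fun t ht => hasDerivAt_gexPrimitive ⟨ht.1, ht.2.trans hx.2⟩)
      integrable_gex.intervalIntegrable,
    gexPrimitive_zero, sub_zero, gexPrimitive_of_ne hx.1.ne']

lemma not_integrableOn_S_gex : ¬ IntegrableOn (S gex) (Ioo 0 1) := by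
  have hmem : Ioo (0 : ℝ) 1 ∈ 𝓝[>] (0 : ℝ) := Ioo_mem_nhdsGT one_pos
  have hderiv : ∀ x ∈ Ioo (0 : ℝ) 1,
      HasDerivAt (fun t => Real.log (2 - Real.log t)) (-S gex x) x := fun x hx => by
    refine (((Real.hasDerivAt_log hx.1.ne').const_sub 2).log
      (two_sub_log_pos hx).ne').congr_deriv ?_
    rw [S_gex_of_mem hx]
    ring
  refine not_integrableOn_of_tendsto_norm_atTop_of_deriv_isBigO_filter
    (f := fun t => Real.log (2 - Real.log t)) (𝓝[>] 0) hmem ?_ ?_ ?_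
  · filter_upwards [hmem] with x hx using (hderiv x hx).differentiableAt
  · exact tendsto_norm_atTop_atTop.comp
      (Real.tendsto_log_atTop.comp tendsto_two_sub_log_nhdsGT_zero)
  · refine Asymptotics.IsBigO.of_bound 1 ?_
    filter_upwards [hmem] with x hx
    rw [(hderiv x hx).deriv, norm_neg, one_mul]

lemma not_inL1PlusLinfty_S_gex : ¬ InL1PlusLinfty (fun x => S gex x) := by
  rintro ⟨g₁, g₂, hg₁, ⟨C, hC⟩, hsum⟩
  have hsub : Ioo (0 : ℝ) 1 ⊆ Ioi 0 := fun _ hx => hx.1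
  have hmeas : AEStronglyMeasurable (S gex) (volume.restrict (Ioo 0 1)) := by
    have h : Measurable fun x : ℝ => 1 / x * (2 - Real.log x)⁻¹ := by fun_prop
    refine h.aestronglyMeasurable.congr ?_
    filter_upwards [ae_restrict_mem measurableSet_Ioo] with x hx using (S_gex_of_mem hx).symm
  have hdom : IntegrableOn (fun x => ‖g₁ x‖ + C) (Ioo 0 1) :=
    (hg₁.mono_set hsub).norm.add (integrableOn_const (by simp))
  refine not_integrableOn_S_gex (Integrable.mono' hdom hmeas ?_)
  filter_upwards [ae_restrict_of_ae_restrict_of_subset hsub hC,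
    ae_restrict_of_ae_restrict_of_subset hsub hsum] with x hx hx'
  rw [hx']
  exact (norm_add_le _ _).trans (by gcongr; exact hx)

lemma distFn_fex {s : ℝ} (hs : 0 ≤ s) : distFn fex s = distFn gex s := by
  have h : {x | x ∈ Ioi (0 : ℝ) ∧ s < |fex x|} =
      (fun x => x - 1) ⁻¹' {x | x ∈ Ioi (0 : ℝ) ∧ s < |gex x|} := by
    ext x
    simp only [fex, mem_ofPred_eq, mem_preimage, mem_Ioi]
    refine and_congr_left fun hx => ?_
    have hmem : x - 1 ∈ Ioo (0 : ℝ) 1 := by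
      by_contra hx'
      rw [gex_of_notMem hx', abs_zero] at hx
      exact hs.not_gt hx
    exact iff_of_true (by linarith [hmem.1]) hmem.1
  rw [distFn, distFn, h]
  exact (measurePreserving_sub_right volume (1 : ℝ)).measure_preimage_emb
    (MeasurableEquiv.subRight (1 : ℝ)).measurableEmbedding _

lemma abs_S_fex_le {x : ℝ} (hx : 0 < x) : |S fex x| ≤ ∫ y, |fex y| := by
  have hint : Integrable fex := integrable_gex.comp_sub_right 1
  rcases le_or_gt x 1 with h1 | h1
  · have h0 : ∫ y in Ioo (0 : ℝ) x, fex y = 0 :=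
      setIntegral_eq_zero_of_forall_eq_zero fun y hy =>
        gex_of_notMem fun h => by linarith [h.1, hy.2]
    rw [S, h0, mul_zero, abs_zero]
    exact integral_nonneg fun _ => abs_nonneg _
  · have hle : |∫ y in Ioo (0 : ℝ) x, fex y| ≤ ∫ y, |fex y| :=
      abs_integral_le_integral_abs.trans
        (setIntegral_le_integral hint.abs (ae_of_all _ fun _ => abs_nonneg _))
    rw [S, abs_mul, abs_of_pos (one_div_pos.2 hx)]
    exact (mul_le_of_le_one_left (abs_nonneg _) ((div_le_one hx).2 h1.le)).trans hle

/-- `f = gex(·-1)` and `g = gex` are equimeasurable, `S f ∈ L^∞ ⊆ L¹+L^∞`, but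
`S g ∉ L¹+L^∞`.  Hence `S` is not bounded on `L¹+L^∞` and the optimal domain
`[S, L¹+L^∞]` is not rearrangement invariant. -/
theorem hardy_not_bounded_on_L1_plus_Linfty :
    (∀ s : ℝ, 0 ≤ s → distFn fex s = distFn gex s) ∧
    (∃ C : ℝ, ∀ x ∈ Ioi (0 : ℝ), |S fex x| ≤ C) ∧
    InL1PlusLinfty (fun x => S fex x) ∧
    ¬ InL1PlusLinfty (fun x => S gex x) := by
  refine ⟨fun s => distFn_fex, ⟨_, fun x => abs_S_fex_le⟩, ?_, not_inL1PlusLinfty_S_gex⟩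
  refine ⟨0, S fex, integrableOn_zero, ⟨∫ y, |fex y|, ?_⟩, ?_⟩
  · filter_upwards [ae_restrict_mem measurableSet_Ioi] with x hx using abs_S_fex_le hx
  · exact ae_of_all _ fun x => by simp
end

section
/- For every real k ≥ 1, the function S(χ_{[k,∞)}) (which equals x ↦ (x−k)/x for x ≥ k and 0 for 0 < x < k) satisfies inf{ ‖g₁‖_{L¹} + ‖g₂‖_{L^∞} : S(χ_{[k,∞)}) = g₁ + g₂ a.e., g₁ ∈ L¹(0,∞), g₂ ∈ L^∞(0,∞) } = 1. (Hence the set function A ↦ S(χ_A), defined on all Borel subsets of (0,∞) with values in L¹+L^∞, is not countably additive.) -/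
open MeasureTheory Set
open scoped ENNReal

/-- The Hardy operator applied to `χ_{[k,∞)}` is `x ↦ max (x - k) 0 / x` on `(0,∞)`. -/
lemma S_indicator_Ici {k : ℝ} (hk : 0 < k) (x : ℝ) :
    S ((Ici k).indicator fun _ => (1 : ℝ)) x = (1 / x) * max (x - k) 0 := by
  have hset : Ioo (0 : ℝ) x ∩ Ici k = Ico k x := by
    ext y
    simp only [mem_inter_iff, mem_Ioo, mem_Ici, mem_Ico]
    exact ⟨fun h => ⟨h.2, h.1.2⟩, fun h => ⟨⟨hk.trans_le h.1, h.2⟩, h.1⟩⟩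
  rw [S, setIntegral_indicator measurableSet_Ici, hset]
  simp [Measure.real, ENNReal.toReal_ofReal']

/-- An integrable function on a half-line is not a.e. bounded away from zero near infinity. -/
lemma not_ae_le_abs_of_integrableOn_Ioi {g : ℝ → ℝ} {a ε : ℝ} (hε : 0 < ε)
    (hg : IntegrableOn g (Ioi a)) : ¬ ∀ᵐ x ∂(volume.restrict (Ioi a)), ε ≤ |g x| := by
  intro h
  have hconst : IntegrableOn (fun _ : ℝ => ε) (Ioi a) := by
    refine Integrable.mono hg aestronglyMeasurable_const ?_
    filter_upwards [h] with x hx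
    rwa [Real.norm_eq_abs, Real.norm_eq_abs, abs_of_pos hε]
  simp [integrableOn_const_iff, hε.ne'] at hconst

/-- For every `k ≥ 1`, the `L¹+L^∞` norm of `S(χ_{[k,∞)})`, i.e. the infimum of
`‖g₁‖_{L¹} + ‖g₂‖_{L^∞}` over all a.e. decompositions `S(χ_{[k,∞)}) = g₁ + g₂` with
`g₁ ∈ L¹(0,∞)` and `g₂ ∈ L^∞(0,∞)`, equals `1`.  (Hence `A ↦ S(χ_A)` is not countably
additive as an `L¹+L^∞`-valued set function on the Borel σ-algebra of `(0,∞)`.) -/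
theorem hardy_indicator_Ici_L1_plus_Linfty_norm (k : ℝ) (hk : 1 ≤ k) :
    sInf {c : ℝ | ∃ g₁ g₂ : ℝ → ℝ, ∃ C : ℝ, 0 ≤ C ∧
        IntegrableOn g₁ (Ioi 0) ∧
        (∀ᵐ x ∂(volume.restrict (Ioi (0 : ℝ))), |g₂ x| ≤ C) ∧
        (∀ᵐ x ∂(volume.restrict (Ioi (0 : ℝ))),
          S ((Ici k).indicator fun _ => (1 : ℝ)) x = g₁ x + g₂ x) ∧
        c = (∫ x in Ioi (0 : ℝ), |g₁ x|) + C} = 1 := by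
  have hk0 : 0 < k := one_pos.trans_le hk
  refine IsLeast.csInf_eq ⟨?_, ?_⟩
  · refine ⟨0, S ((Ici k).indicator fun _ => (1 : ℝ)), 1, zero_le_one, integrableOn_zero,
      ?_, ?_, ?_⟩
    · filter_upwards [ae_restrict_mem measurableSet_Ioi] with x hx
      have hx0 : 0 < x := hx
      rw [S_indicator_Ici hk0, abs_of_nonneg (by positivity), one_div_mul_eq_div,
        div_le_one hx0]
      exact max_le (by linarith) hx0.le
    · simp
    · simp
  · rintro c ⟨g₁, g₂, C, hC, hg₁, hg₂, hS, rfl⟩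
    have hnonneg : 0 ≤ ∫ x in Ioi (0 : ℝ), |g₁ x| := integral_nonneg fun x => abs_nonneg _
    suffices 1 ≤ C by linarith
    by_contra! hlt
    have hδ : 0 < (1 - C) / 2 := by linarith
    have hM : 0 < k / ((1 - C) / 2) := div_pos hk0 hδ
    have hsub : Ioi (k / ((1 - C) / 2)) ⊆ Ioi (0 : ℝ) := Ioi_subset_Ioi hM.le
    refine not_ae_le_abs_of_integrableOn_Ioi hδ (hg₁.mono_set hsub) ?_
    filter_upwards [ae_restrict_of_ae_restrict_of_subset hsub hg₂,
      ae_restrict_of_ae_restrict_of_subset hsub hS, ae_restrict_mem measurableSet_Ioi]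
      with x hx₂ hxS hx
    have hx0 : 0 < x := hsub hx
    have hkx : k / x ≤ (1 - C) / 2 := (div_lt_comm₀ hδ hx0).mp hx |>.le
    have hSx : 1 - k / x ≤ g₁ x + g₂ x := by
      rw [← hxS, S_indicator_Ici hk0, one_div_mul_eq_div, ← div_self hx0.ne', ← sub_div]
      gcongr
      exact le_max_left _ _
    linarith [le_abs_self (g₁ x), le_abs_self (g₂ x)]
end

section
/- Let φ : [0,∞) → [0,∞) be nondecreasing, concave, and continuous with φ(0) = 0, with a.e. derivative φ′, and set θ_φ(y) = ∫_y^∞ φ′(t)/t dt. Then for every t > 0, ∫₀ᵗ θ_φ(s) ds = φ(t) + t·θ_φ(t), as an identity in [0,∞]. Consequently, there exists a constant C > 0 with ∫₀ᵗ θ_φ(s) ds ≤ C·φ(t) for all t > 0 if and only if there exists a constant C′ > 0 with t·θ_φ(t) ≤ C′·φ(t) for all t > 0. -/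
open MeasureTheory Set
open scoped ENNReal

/-- `θ_φ(y) = ∫_y^∞ φ'(t)/t dt`, as a value in `[0,∞]`. -/
noncomputable def theta (φ' : ℝ → ℝ) (y : ℝ) : ℝ≥0∞ :=
  ∫⁻ t in Ioi y, ENNReal.ofReal (φ' t / t)

/-- Tonelli's theorem for a tail integral: integrating `∫_s^∞ g` over `s ∈ (0, t)` weighs `g u`
by `u` on `(0, t)` and by `t` on `(t, ∞)`. -/
theorem lintegral_Ioo_lintegral_Ioi {g : ℝ → ℝ≥0∞} (hg : Measurable g) {t : ℝ} (ht : 0 < t) :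
    ∫⁻ s in Ioo (0 : ℝ) t, ∫⁻ u in Ioi s, g u
      = (∫⁻ u in Ioo (0 : ℝ) t, ENNReal.ofReal u * g u)
        + ENNReal.ofReal t * ∫⁻ u in Ioi t, g u := by
  have hmeas : Measurable (Function.uncurry fun s u : ℝ => (Ioi s).indicator g u) :=
    (hg.comp measurable_snd).indicator (measurableSet_lt measurable_fst measurable_snd)
  have hslice (u : ℝ) : ∫⁻ s in Ioo (0 : ℝ) t, (Ioi s).indicator g u
      = ENNReal.ofReal (min t u) * g u := by
    have h (s : ℝ) : (Ioi s).indicator g u = (Iio u).indicator (fun _ => g u) s := by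
      simp [indicator_apply]
    simp_rw [h]
    rw [lintegral_indicator_const measurableSet_Iio, Measure.restrict_apply measurableSet_Iio,
      inter_comm, Ioo_inter_Iio, Real.volume_Ioo, sub_zero, mul_comm]
  calc ∫⁻ s in Ioo (0 : ℝ) t, ∫⁻ u in Ioi s, g u
      = ∫⁻ s in Ioo (0 : ℝ) t, ∫⁻ u, (Ioi s).indicator g u := by
        simp_rw [lintegral_indicator measurableSet_Ioi]
    _ = ∫⁻ u, ENNReal.ofReal (min t u) * g u := by
        rw [lintegral_lintegral_swap hmeas.aemeasurable]
        simp_rw [hslice]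
    _ = ∫⁻ u in Ioi 0, ENNReal.ofReal (min t u) * g u := by
        refine (setLIntegral_eq_of_support_subset fun u hu => ?_).symm
        by_contra h
        exact hu (by simp [ENNReal.ofReal_of_nonpos ((min_le_right t u).trans (not_lt.1 h))])
    _ = (∫⁻ u in Ioc 0 t, ENNReal.ofReal (min t u) * g u)
          + ∫⁻ u in Ioi t, ENNReal.ofReal (min t u) * g u := by
        rw [← Ioc_union_Ioi_eq_Ioi ht.le, lintegral_union measurableSet_Ioi
          (Ioc_disjoint_Ioi le_rfl)]
    _ = _ := by
        rw [← lintegral_const_mul _ hg, restrict_Ioo_eq_restrict_Ioc]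
        congr 1
        · exact setLIntegral_congr_fun measurableSet_Ioc fun u hu => by simp [min_eq_right hu.2]
        · exact setLIntegral_congr_fun measurableSet_Ioi fun u hu => by
            rw [min_eq_left (mem_Ioi.1 hu).le]

/-- For `φ` nondecreasing, concave and continuous on `[0,∞)` with `φ(0) = 0` and a.e.
derivative `φ'`, one has `∫₀ᵗ θ_φ(s) ds = φ(t) + t·θ_φ(t)` for every `t > 0`, as an
identity in `[0,∞]`.  Consequently `∫₀ᵗ θ_φ ≤ C·φ(t)` (for all `t > 0`, some `C > 0`)
iff `t·θ_φ(t) ≤ C'·φ(t)` (for all `t > 0`, some `C' > 0`). -/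
theorem integral_theta_eq_phi_add (φ φ' : ℝ → ℝ)
    (hmono : MonotoneOn φ (Ici 0)) (hconc : ConcaveOn ℝ (Ici 0) φ)
    (hcont : ContinuousOn φ (Ici 0)) (hφ0 : φ 0 = 0)
    (hφ'meas : Measurable φ') (hφ'nn : ∀ t ∈ Ioi (0 : ℝ), 0 ≤ φ' t)
    (hφ'anti : AntitoneOn φ' (Ioi 0))
    (hFTC : ∀ t > (0 : ℝ),
      ENNReal.ofReal (φ t) = ∫⁻ s in Ioo (0 : ℝ) t, ENNReal.ofReal (φ' s)) :
    (∀ t > (0 : ℝ), (∫⁻ s in Ioo (0 : ℝ) t, theta φ' s)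
        = ENNReal.ofReal (φ t) + ENNReal.ofReal t * theta φ' t) ∧
    ((∃ C > (0 : ℝ), ∀ t > (0 : ℝ),
        (∫⁻ s in Ioo (0 : ℝ) t, theta φ' s) ≤ ENNReal.ofReal (C * φ t)) ↔
      (∃ C > (0 : ℝ), ∀ t > (0 : ℝ),
        ENNReal.ofReal t * theta φ' t ≤ ENNReal.ofReal (C * φ t))) := by
  have key : ∀ t > (0 : ℝ), (∫⁻ s in Ioo (0 : ℝ) t, theta φ' s)
      = ENNReal.ofReal (φ t) + ENNReal.ofReal t * theta φ' t := by
    intro t ht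
    have hg : Measurable fun u => ENNReal.ofReal (φ' u / u) :=
      (hφ'meas.div measurable_id).ennreal_ofReal
    unfold theta
    rw [lintegral_Ioo_lintegral_Ioi hg ht, hFTC t ht]
    congr 1
    refine setLIntegral_congr_fun measurableSet_Ioo fun u hu => ?_
    rw [← ENNReal.ofReal_mul hu.1.le, mul_div_cancel₀ _ hu.1.ne']
  refine ⟨key, ?_, ?_⟩
  · rintro ⟨C, hC, h⟩
    exact ⟨C, hC, fun t ht => le_add_self.trans ((key t ht).symm.le.trans (h t ht))⟩
  · rintro ⟨C, hC, h⟩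
    refine ⟨1 + C, by positivity, fun t ht => ?_⟩
    have hφt : 0 ≤ φ t := hφ0 ▸ hmono self_mem_Ici ht.le ht.le
    rw [key t ht, add_mul, one_mul, ENNReal.ofReal_add hφt (by positivity)]
    gcongr
    exact h t ht
end

section
/- Let φ : [0,∞) → [0,∞) satisfy φ(0) = 0 and be nondecreasing and concave on (0,∞) (a jump at 0, i.e. φ(0⁺) > 0, is allowed), with a.e. derivative φ′, and set θ_φ(y) = ∫_y^∞ φ′(t)/t dt. Let 𝓡 be the δ-ring of all Borel sets A ⊆ (0,∞) with finite Lebesgue measure such that |A ∩ (0,ε]| = 0 for some ε > 0. Then the following are equivalent: (i) θ_φ(y) < ∞ for every y > 0; (ii) for every A ∈ 𝓡, the function S(χ_A) belongs to the Lorentz space Λ_φ, i.e. ∫₀^∞ φ(λ_{S(χ_A)}(s)) ds < ∞. -/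
open MeasureTheory Set
open scoped ENNReal

/-- The natural extension of `φ` to `[0,∞]` (with `φ(∞) = sup_{t>0} φ(t)`). -/
noncomputable def PhiE (φ : ℝ → ℝ) (m : ℝ≥0∞) : ℝ≥0∞ :=
  if m = ⊤ then ⨆ t ∈ Ioi (0 : ℝ), ENNReal.ofReal (φ t) else ENNReal.ofReal (φ m.toReal)

/-- The Lorentz functional `‖g‖_{Λ_φ} = ∫₀^∞ φ(λ_g(s)) ds`. -/
noncomputable def lorentzNorm (φ : ℝ → ℝ) (g : ℝ → ℝ) : ℝ≥0∞ :=
  ∫⁻ s in Ioi (0 : ℝ), PhiE φ (distFn g s)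

/-- Tonelli for the region `{(s, t) | 0 < s < a, 0 < t < m / s}`. -/
theorem lintegral_Ioo_lintegral_Ioo_div {F : ℝ → ℝ≥0∞} (hF : Measurable F) {a m : ℝ} :
    ∫⁻ s in Ioo 0 a, ∫⁻ t in Ioo 0 (m / s), F t =
      ∫⁻ t in Ioi 0, F t * ENNReal.ofReal (min a (m / t)) := by
  have hset : MeasurableSet {p : ℝ × ℝ | p.2 < m / p.1} :=
    measurableSet_lt measurable_snd (measurable_const.div measurable_fst)
  have hslice : ∀ s : ℝ, ∫⁻ t in Ioo 0 (m / s), F t =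
      ∫⁻ t in Ioi 0, {p : ℝ × ℝ | p.2 < m / p.1}.indicator (fun p => F p.2) (s, t) := by
    intro s
    have : (fun t => {p : ℝ × ℝ | p.2 < m / p.1}.indicator (fun p => F p.2) (s, t)) =
        (Iio (m / s)).indicator F := by
      ext t; simp [indicator]
    rw [this, setLIntegral_indicator measurableSet_Iio, inter_comm, Ioi_inter_Iio]
  simp_rw [hslice]
  have hmeas : Measurable (Function.uncurry fun s t : ℝ =>
      {p : ℝ × ℝ | p.2 < m / p.1}.indicator (fun p => F p.2) (s, t)) :=
    (hF.comp measurable_snd).indicator hset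
  rw [lintegral_lintegral_swap hmeas.aemeasurable]
  refine setLIntegral_congr_fun measurableSet_Ioi fun t (ht : 0 < t) => ?_
  have : ∀ s ∈ Ioo 0 a, {p : ℝ × ℝ | p.2 < m / p.1}.indicator (fun p => F p.2) (s, t) =
      (Iio (m / t)).indicator (fun _ => F t) s := by
    intro s hs
    have : t < m / s ↔ s < m / t := by
      rw [lt_div_iff₀ hs.1, lt_div_iff₀ ht, mul_comm]
    simp [indicator, this]
  rw [setLIntegral_congr_fun measurableSet_Ioo this, setLIntegral_indicator measurableSet_Iio,
    setLIntegral_const, inter_comm, Ioo_inter_Iio, Real.volume_Ioo, sub_zero]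

theorem monotone_PhiE {φ : ℝ → ℝ} (hφ0 : φ 0 = 0) (hmono : MonotoneOn φ (Ioi 0)) :
    Monotone (PhiE φ) := by
  intro a b hab
  rcases eq_or_ne a 0 with rfl | ha
  · simp [PhiE, hφ0]
  rcases eq_or_ne b ⊤ with rfl | hb
  · rcases eq_or_ne a ⊤ with rfl | ha'
    · rfl
    · simp only [PhiE, ha', if_true, if_false]
      exact le_iSup₂_of_le (f := fun t (_ : t ∈ Ioi (0 : ℝ)) => ENNReal.ofReal (φ t)) a.toReal
        (ENNReal.toReal_pos ha ha') le_rfl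
  · have ha' : a ≠ ⊤ := ne_top_of_le_ne_top hb hab
    simp only [PhiE, ha', hb, if_false]
    have hpos : 0 < a.toReal := ENNReal.toReal_pos ha ha'
    have hle : a.toReal ≤ b.toReal := ENNReal.toReal_mono hb hab
    exact ENNReal.ofReal_le_ofReal (hmono hpos (hpos.trans_le hle) hle)

theorem PhiE_ofReal {φ : ℝ → ℝ} {t : ℝ} (ht : 0 ≤ t) :
    PhiE φ (ENNReal.ofReal t) = ENNReal.ofReal (φ t) := by
  simp [PhiE, ENNReal.toReal_ofReal ht]

theorem S_indicator_one {A : Set ℝ} (hA : MeasurableSet A) (x : ℝ) :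
    S (A.indicator fun _ => (1 : ℝ)) x = volume.real (A ∩ Ioo 0 x) / x := by
  rw [S, integral_indicator_const _ hA, measureReal_restrict_apply hA, smul_eq_mul, mul_one,
    one_div_mul_eq_div]

theorem distFn_S_indicator_le {A : Set ℝ} (hA : MeasurableSet A) (hfin : volume A < ⊤)
    {m s : ℝ} (hm : volume.real A ≤ m) (hs : 0 < s) :
    distFn (fun x => S (A.indicator fun _ => (1 : ℝ)) x) s ≤ ENNReal.ofReal (m / s) := by
  rw [← sub_zero (m / s), ← Real.volume_Ioo]
  refine measure_mono fun x hx => ?_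
  obtain ⟨hx0 : 0 < x, hx : s < |S (A.indicator fun _ => (1 : ℝ)) x|⟩ := hx
  refine ⟨hx0, ?_⟩
  rw [S_indicator_one hA, abs_of_nonneg (by positivity), lt_div_iff₀ hx0] at hx
  rw [lt_div_iff₀ hs, mul_comm]
  exact hx.trans_le ((measureReal_mono inter_subset_left hfin.ne).trans hm)

theorem distFn_S_indicator_eq_zero {A : Set ℝ} (hA : MeasurableSet A) {s : ℝ} (hs : 1 ≤ s) :
    distFn (fun x => S (A.indicator fun _ => (1 : ℝ)) x) s = 0 := by
  have : {x | x ∈ Ioi (0 : ℝ) ∧ s < |S (A.indicator fun _ => (1 : ℝ)) x|} = ∅ := by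
    refine eq_empty_of_forall_notMem fun x ⟨(hx0 : 0 < x), hx⟩ => ?_
    rw [S_indicator_one hA, abs_of_nonneg (by positivity), lt_div_iff₀ hx0] at hx
    have : volume.real (A ∩ Ioo 0 x) ≤ x := by
      calc volume.real (A ∩ Ioo 0 x) ≤ volume.real (Ioo 0 x) :=
            measureReal_mono inter_subset_right (by simp)
        _ = x := by simp [hx0.le]
    nlinarith
  rw [distFn, this, measure_empty]

theorem ofReal_div_le_distFn_S_indicator_Ioc {y s : ℝ} (hy : 0 < y) (hs : s ∈ Ioo 0 (1 / 4)) :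
    ENNReal.ofReal (y / 2 / s) ≤
      distFn (fun x => S ((Ioc y (2 * y)).indicator fun _ => (1 : ℝ)) x) s := by
  obtain ⟨hs0, hs1⟩ := hs
  have hlen : y / 2 / s ≤ y / s - 2 * y := by
    rw [le_sub_iff_add_le, div_add' _ _ _ hs0.ne', div_le_div_iff_of_pos_right hs0]
    nlinarith
  calc ENNReal.ofReal (y / 2 / s) ≤ ENNReal.ofReal (y / s - 2 * y) :=
        ENNReal.ofReal_le_ofReal hlen
    _ = volume (Ioo (2 * y) (y / s)) := Real.volume_Ioo.symm
    _ ≤ _ := by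
      refine measure_mono fun x hx => ?_
      have hx0 : 0 < x := by linarith [hx.1]
      have hsub : Ioc y (2 * y) ∩ Ioo 0 x = Ioc y (2 * y) :=
        inter_eq_left.2 fun z hz => ⟨hy.trans hz.1, hz.2.trans_lt hx.1⟩
      refine ⟨hx0, ?_⟩
      have hx2 := hx.2
      rw [lt_div_iff₀ hs0] at hx2
      beta_reduce
      rw [S_indicator_one measurableSet_Ioc, hsub, abs_of_nonneg (by positivity),
        lt_div_iff₀ hx0, Real.volume_real_Ioc_of_le (by linarith)]
      linarith

/-- For `φ` nondecreasing and concave on `(0,∞)` with `φ(0) = 0` (a jump `φ(0⁺) = c ≥ 0`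
is allowed) and a.e. derivative `φ'`:  `θ_φ(y) < ∞` for all `y > 0` iff `S(χ_A) ∈ Λ_φ`
for every Borel `A ⊆ (0,∞)` of finite measure bounded away from `0` (i.e. for every `A`
in the δ-ring `𝓡`). -/
theorem theta_finite_iff_hardy_indicator_mem_lorentz (φ φ' : ℝ → ℝ) (c : ℝ) (hc : 0 ≤ c)
    (hφnn : ∀ t : ℝ, 0 ≤ t → 0 ≤ φ t) (hφ0 : φ 0 = 0)
    (hmono : MonotoneOn φ (Ioi 0)) (hconc : ConcaveOn ℝ (Ioi 0) φ)
    (hφ'meas : Measurable φ') (hφ'nn : ∀ t ∈ Ioi (0 : ℝ), 0 ≤ φ' t)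
    (hφ'anti : AntitoneOn φ' (Ioi 0))
    (hφ'int : ∀ t > (0 : ℝ), IntegrableOn φ' (Ioo 0 t))
    (hFTC : ∀ t > (0 : ℝ), φ t = c + ∫ s in Ioo (0 : ℝ) t, φ' s) :
    (∀ y > (0 : ℝ), theta φ' y < ⊤) ↔
      (∀ A : Set ℝ, MeasurableSet A → A ⊆ Ioi 0 → volume A < ⊤ →
        (∃ ε > (0 : ℝ), volume (A ∩ Ioc 0 ε) = 0) →
        lorentzNorm φ (fun x => S (A.indicator fun _ => (1 : ℝ)) x) < ⊤) := by
  set F : ℝ → ℝ≥0∞ := fun t => ENNReal.ofReal (φ' t) with hFdef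
  have hF : Measurable F := hφ'meas.ennreal_ofReal
  have hlin : ∀ t > 0, ENNReal.ofReal (∫ s in Ioo 0 t, φ' s) = ∫⁻ s in Ioo 0 t, F s :=
    fun t ht => ofReal_integral_eq_lintegral_ofReal (hφ'int t ht)
      ((ae_restrict_iff' measurableSet_Ioo).2 (.of_forall fun s hs => hφ'nn s hs.1))
  have hφlin : ∀ t > 0, ENNReal.ofReal (φ t) = ENNReal.ofReal c + ∫⁻ s in Ioo 0 t, F s := by
    intro t ht
    rw [hFTC t ht, ENNReal.ofReal_add hc
      (setIntegral_nonneg measurableSet_Ioo fun s hs => hφ'nn s hs.1), hlin t ht]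
  have htheta : ∀ y m : ℝ, 0 < y → 0 < m →
      ∫⁻ t in Ioi y, F t * ENNReal.ofReal (m / t) = theta φ' y * ENNReal.ofReal m := by
    intro y m hy hm
    have hmeas : Measurable fun t => ENNReal.ofReal (φ' t / t) :=
      (hφ'meas.div measurable_id).ennreal_ofReal
    rw [theta, ← lintegral_mul_const _ hmeas]
    refine setLIntegral_congr_fun measurableSet_Ioi fun t (ht : y < t) => ?_
    have ht0 : 0 < t := hy.trans ht
    have hφt := hφ'nn t ht0
    simp only [hFdef]
    rw [← ENNReal.ofReal_mul hφt, ← ENNReal.ofReal_mul (by positivity)]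
    congr 1
    ring
  constructor
  · intro hθ A hA _ hfin _
    set m : ℝ := volume.real A + 1 with hmdef
    have hm : 0 < m := by positivity
    have hbound : ∀ s ∈ Ioi (0 : ℝ),
        PhiE φ (distFn (fun x => S (A.indicator fun _ => (1 : ℝ)) x) s) ≤
          (Iio 1).indicator (fun s => ENNReal.ofReal c + ∫⁻ t in Ioo 0 (m / s), F t) s := by
      intro s (hs : 0 < s)
      by_cases h1 : s < 1
      · rw [indicator_of_mem (mem_Iio.2 h1), ← hφlin _ (by positivity),
          ← PhiE_ofReal (by positivity)]
        exact monotone_PhiE hφ0 hmono (distFn_S_indicator_le hA hfin (by simp [hmdef]) hs)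
      · rw [distFn_S_indicator_eq_zero hA (not_lt.1 h1)]
        simp [PhiE, hφ0]
    refine (setLIntegral_mono' measurableSet_Ioi hbound).trans_lt ?_
    rw [setLIntegral_indicator measurableSet_Iio, inter_comm, Ioi_inter_Iio,
      lintegral_add_left measurable_const, lintegral_Ioo_lintegral_Ioo_div hF,
      ← Ioc_union_Ioi_eq_Ioi hm.le]
    refine ENNReal.add_lt_top.2 ⟨?_, (lintegral_union_le _ _ _).trans_lt
      (ENNReal.add_lt_top.2 ⟨?_, ?_⟩)⟩
    · simp
    · calc ∫⁻ t in Ioc 0 m, F t * ENNReal.ofReal (min 1 (m / t)) ≤ ∫⁻ t in Ioc 0 m, F t :=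
            lintegral_mono fun t => mul_le_of_le_one_right' (by simp)
        _ = ∫⁻ t in Ioo 0 m, F t := by rw [restrict_Ioo_eq_restrict_Ioc]
        _ < ⊤ := by rw [← hlin m hm]; exact ENNReal.ofReal_lt_top
    · calc ∫⁻ t in Ioi m, F t * ENNReal.ofReal (min 1 (m / t)) ≤
            ∫⁻ t in Ioi m, F t * ENNReal.ofReal (m / t) :=
            lintegral_mono fun t => by gcongr; exact min_le_right _ _
        _ = theta φ' m * ENNReal.ofReal m := htheta m m hm hm
        _ < ⊤ := ENNReal.mul_lt_top (hθ m hm) ENNReal.ofReal_lt_top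
  · intro h y₀ hy₀
    obtain ⟨y, hy, rfl⟩ : ∃ y : ℝ, 0 < y ∧ y₀ = 2 * y := ⟨y₀ / 2, by positivity, by ring⟩
    have hfin := h (Ioc y (2 * y)) measurableSet_Ioc (fun x hx => hy.trans hx.1) (by simp)
      ⟨y, hy, by simp [Ioc_inter_Ioc, hy.le]⟩
    have hy2 : 0 < y / 2 := by positivity
    have hle : theta φ' (2 * y) * ENNReal.ofReal (y / 2) ≤
        lorentzNorm φ (fun x => S ((Ioc y (2 * y)).indicator fun _ => (1 : ℝ)) x) := by
      calc theta φ' (2 * y) * ENNReal.ofReal (y / 2)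
          = ∫⁻ t in Ioi (2 * y), F t * ENNReal.ofReal (y / 2 / t) :=
            (htheta _ _ (by positivity) hy2).symm
        _ = ∫⁻ t in Ioi (2 * y), F t * ENNReal.ofReal (min (1 / 4) (y / 2 / t)) := by
            refine setLIntegral_congr_fun measurableSet_Ioi fun t (ht : 2 * y < t) => ?_
            have : y / 2 / t ≤ 1 / 4 := by
              rw [div_le_iff₀ (by linarith)]; linarith
            simp only [min_eq_right this]
        _ ≤ ∫⁻ t in Ioi 0, F t * ENNReal.ofReal (min (1 / 4) (y / 2 / t)) :=
            lintegral_mono_set (Ioi_subset_Ioi (by positivity))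
        _ = ∫⁻ s in Ioo 0 (1 / 4), ∫⁻ t in Ioo 0 (y / 2 / s), F t :=
            (lintegral_Ioo_lintegral_Ioo_div hF).symm
        _ ≤ ∫⁻ s in Ioo 0 (1 / 4), PhiE φ
              (distFn (fun x => S ((Ioc y (2 * y)).indicator fun _ => (1 : ℝ)) x) s) := by
            refine setLIntegral_mono' measurableSet_Ioo fun s hs => ?_
            have hpos : 0 < y / 2 / s := div_pos hy2 hs.1
            calc ∫⁻ t in Ioo 0 (y / 2 / s), F t ≤ ENNReal.ofReal (φ (y / 2 / s)) := by
                  rw [hφlin _ hpos]; exact le_add_self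
              _ = PhiE φ (ENNReal.ofReal (y / 2 / s)) := (PhiE_ofReal hpos.le).symm
              _ ≤ _ := monotone_PhiE hφ0 hmono (ofReal_div_le_distFn_S_indicator_Ioc hy hs)
        _ ≤ _ := lintegral_mono_set Ioo_subset_Ioi_self
    refine lt_top_iff_ne_top.2 fun htop => ?_
    rw [htop, ENNReal.top_mul (ENNReal.ofReal_pos.2 hy2).ne', top_le_iff] at hle
    exact hfin.ne hle
end

section
/- Let φ : [0,∞) → [0,∞) be nondecreasing, concave, and continuous with φ(0) = 0, with a.e. derivative φ′, and set θ_φ(y) = ∫_y^∞ φ′(t)/t dt. Then for every nonincreasing measurable f : (0,∞) → [0,∞), one has ‖Sf‖_{Λ_φ} = ∫₀^∞ f(s)·θ_φ(s) ds, as an equality in [0,∞]. In particular, Sf ∈ Λ_φ if and only if ∫₀^∞ f(s)·θ_φ(s) ds < ∞. -/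
open MeasureTheory Set
open scoped ENNReal

/-- The Hardy operator maps nonincreasing functions to nonincreasing functions. -/
theorem S_antitoneOn {f : ℝ → ℝ} (hfanti : AntitoneOn f (Ioi 0))
    (hfloc : ∀ x > (0 : ℝ), IntegrableOn f (Ioo 0 x)) : AntitoneOn (S f) (Ioi 0) := by
  have hfint : ∀ x > (0 : ℝ), IntervalIntegrable f volume 0 x := fun x hx =>
    (intervalIntegrable_iff_integrableOn_Ioo_of_le hx.le).2 (hfloc x hx)
  have hS : ∀ x > (0 : ℝ), S f x = ∫ u in (0 : ℝ)..1, f (x * u) := by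
    intro x hx
    rw [S, intervalIntegral.integral_comp_mul_left f hx.ne', ← integral_Ioc_eq_integral_Ioo,
      mul_zero, mul_one, intervalIntegral.integral_of_le hx.le, smul_eq_mul, one_div]
  have hfint' : ∀ x > (0 : ℝ), IntervalIntegrable (fun u => f (x * u)) volume 0 1 := by
    intro x hx
    simpa [hx.ne'] using (hfint x hx).comp_mul_left (c := x)
  intro x hx y hy hxy
  rw [hS x hx, hS y hy]
  refine intervalIntegral.integral_mono_on_of_le_Ioo zero_le_one (hfint' y hy) (hfint' x hx) ?_
  intro u hu
  exact hfanti (mul_pos hx hu.1) (mul_pos hy hu.1) (mul_le_mul_of_nonneg_right hxy hu.1.le)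

theorem S_nonneg {f : ℝ → ℝ} (hfnn : ∀ x ∈ Ioi (0 : ℝ), 0 ≤ f x) {x : ℝ} (hx : 0 < x) :
    0 ≤ S f x :=
  mul_nonneg (one_div_pos.2 hx).le
    (setIntegral_nonneg measurableSet_Ioo fun y hy => hfnn y hy.1)

theorem ofReal_S {f : ℝ → ℝ} (hfnn : ∀ x ∈ Ioi (0 : ℝ), 0 ≤ f x)
    (hfloc : ∀ x > (0 : ℝ), IntegrableOn f (Ioo 0 x)) {x : ℝ} (hx : 0 < x) :
    ENNReal.ofReal (S f x)
      = ENNReal.ofReal (1 / x) * ∫⁻ y in Ioo (0 : ℝ) x, ENNReal.ofReal (f y) := by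
  rw [S, ENNReal.ofReal_mul (one_div_pos.2 hx).le, ofReal_integral_eq_lintegral_ofReal (hfloc x hx)]
  filter_upwards [ae_restrict_mem measurableSet_Ioo] with y hy using hfnn y hy.1

/-- `φ(|A|) = ∫_A φ'` for an initial segment `A` of `(0,∞)`. -/
theorem PhiE_volume_eq_lintegral {φ φ' : ℝ → ℝ} (hφ0 : φ 0 = 0)
    (hFTC : ∀ t > (0 : ℝ),
      ENNReal.ofReal (φ t) = ∫⁻ s in Ioo (0 : ℝ) t, ENNReal.ofReal (φ' s))
    {A : Set ℝ} (hA : A ⊆ Ioi 0) (hdown : ∀ x ∈ A, ∀ y, 0 < y → y ≤ x → y ∈ A) :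
    PhiE φ (volume A) = ∫⁻ t in A, ENNReal.ofReal (φ' t) := by
  rcases A.eq_empty_or_nonempty with rfl | hne
  · simp [PhiE, hφ0]
  by_cases hb : BddAbove A
  · obtain ⟨x, hx⟩ := hne
    have ha : 0 < sSup A := (hA hx).trans_le (le_csSup hb hx)
    have hsub : Ioo 0 (sSup A) ⊆ A := by
      intro y hy
      obtain ⟨z, hz, hyz⟩ := exists_lt_of_lt_csSup ⟨x, hx⟩ hy.2
      exact hdown z hz y hy.1 hyz.le
    have hsup : A ⊆ Ioc 0 (sSup A) := fun y hy => ⟨hA hy, le_csSup hb hy⟩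
    have hae : A =ᵐ[volume] Ioo 0 (sSup A) :=
      (hsup.eventuallyLE.trans Ioo_ae_eq_Ioc.symm.le).antisymm hsub.eventuallyLE
    rw [measure_congr hae, setLIntegral_congr hae, ← hFTC _ ha]
    simp [PhiE, ha.le]
  · have hAeq : A = Ioi 0 := by
      refine hA.antisymm fun y hy => ?_
      obtain ⟨z, hz, hyz⟩ := not_bddAbove_iff.1 hb y
      exact hdown z hz y hy hyz.le
    rw [hAeq, Real.volume_Ioi, PhiE, if_pos rfl]
    apply le_antisymm
    · refine iSup₂_le fun t ht => ?_
      rw [hFTC t ht]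
      exact lintegral_mono_set Ioo_subset_Ioi_self
    · have hU : Ioi (0 : ℝ) = ⋃ n : ℕ, Ioo (0 : ℝ) (n + 1) := by
        ext y
        simp only [mem_Ioi, mem_iUnion, mem_Ioo]
        refine ⟨fun hy => ?_, fun ⟨_, h, _⟩ => h⟩
        obtain ⟨n, hn⟩ := exists_nat_gt y
        exact ⟨n, hy, by linarith⟩
      rw [hU, setLIntegral_iUnion_of_directed]
      · refine iSup_le fun n => ?_
        have hn : (0 : ℝ) < n + 1 := by positivity
        rw [← hFTC _ hn, ← hU]
        exact le_iSup₂ (f := fun t (_ : t ∈ Ioi (0 : ℝ)) => ENNReal.ofReal (φ t)) _ hn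
      · refine Monotone.directed_le fun m n hmn => Ioo_subset_Ioo_right ?_
        gcongr

/-- Layer-cake formula for the Lorentz functional of a nonincreasing function. -/
theorem lorentzNorm_of_antitoneOn {φ φ' : ℝ → ℝ} (hφ0 : φ 0 = 0) (hφ'meas : Measurable φ')
    (hFTC : ∀ t > (0 : ℝ),
      ENNReal.ofReal (φ t) = ∫⁻ s in Ioo (0 : ℝ) t, ENNReal.ofReal (φ' s))
    {g : ℝ → ℝ} (hgnn : ∀ x ∈ Ioi (0 : ℝ), 0 ≤ g x) (hganti : AntitoneOn g (Ioi 0)) :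
    lorentzNorm φ g
      = ∫⁻ t in Ioi (0 : ℝ), ENNReal.ofReal (φ' t) * ENNReal.ofReal (g t) := by
  have hφm : Measurable fun t => ENNReal.ofReal (φ' t) := hφ'meas.ennreal_ofReal
  have hgm : AEMeasurable g (volume.restrict (Ioi 0)) :=
    aemeasurable_restrict_of_antitoneOn measurableSet_Ioi hganti
  set μ := (volume.restrict (Ioi (0 : ℝ))).withDensity fun t => ENNReal.ofReal (φ' t) with hμ
  have hac : μ ≪ volume.restrict (Ioi (0 : ℝ)) := withDensity_absolutelyContinuous _ _
  have hnn : 0 ≤ᵐ[volume.restrict (Ioi (0 : ℝ))] g := by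
    filter_upwards [ae_restrict_mem measurableSet_Ioi] with x hx using hgnn x hx
  have hlayer := lintegral_eq_lintegral_meas_lt μ (hac.ae_le hnn) (hgm.mono_ac hac)
  rw [hμ, lintegral_withDensity_eq_lintegral_mul₀ hφm.aemeasurable hgm.ennreal_ofReal, ← hμ]
    at hlayer
  refine Eq.trans ?_ hlayer.symm
  refine lintegral_congr fun s => ?_
  have hset : {x | x ∈ Ioi (0 : ℝ) ∧ s < |g x|} = {x | s < g x} ∩ Ioi 0 := by
    ext x
    refine ⟨fun ⟨hx, h⟩ => ⟨by rwa [abs_of_nonneg (hgnn x hx)] at h, hx⟩,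
      fun ⟨h, hx⟩ => ⟨hx, by rwa [abs_of_nonneg (hgnn x hx)]⟩⟩
  have hord : OrdConnected ({x | s < g x} ∩ Ioi 0) := by
    refine ⟨fun x hx y hy z hz => ?_⟩
    have hz0 : z ∈ Ioi (0 : ℝ) := hx.2.trans_le hz.1
    exact ⟨hy.1.trans_le (hganti hz0 hy.2 hz.2), hz0⟩
  rw [distFn, hset, PhiE_volume_eq_lintegral hφ0 hFTC inter_subset_right
    fun x hx y hy hyx => ⟨hx.1.trans_le (hganti hy hx.2 hyx), hy⟩]
  have hmem : ∀ᵐ t ∂μ, t ∈ Ioi (0 : ℝ) := hac.ae_le (ae_restrict_mem measurableSet_Ioi)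
  have hμeq : μ {x | s < g x} = μ ({x | s < g x} ∩ Ioi 0) := by
    refine measure_congr ?_
    filter_upwards [hmem] with t ht
    exact propext ⟨fun h => ⟨h, ht⟩, fun h => h.1⟩
  rw [hμeq, hμ, withDensity_apply _ hord.measurableSet,
    Measure.restrict_restrict_of_subset inter_subset_right]

theorem lintegral_mul_lintegral_Ioo_eq {a b : ℝ → ℝ≥0∞} (ha : Measurable a) (hb : Measurable b) :
    ∫⁻ t in Ioi (0 : ℝ), a t * ∫⁻ s in Ioo (0 : ℝ) t, b s
      = ∫⁻ s in Ioi (0 : ℝ), b s * ∫⁻ t in Ioi s, a t := by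
  have hK : Measurable fun p : ℝ × ℝ =>
      {q : ℝ × ℝ | q.2 < q.1}.indicator (fun q => a q.1 * b q.2) p :=
    ((ha.comp measurable_fst).mul (hb.comp measurable_snd)).indicator
      (measurableSet_lt measurable_snd measurable_fst)
  calc ∫⁻ t in Ioi (0 : ℝ), a t * ∫⁻ s in Ioo (0 : ℝ) t, b s
      = ∫⁻ t in Ioi (0 : ℝ), ∫⁻ s in Ioi (0 : ℝ),
          {q : ℝ × ℝ | q.2 < q.1}.indicator (fun q => a q.1 * b q.2) (t, s) := by
        refine lintegral_congr fun t => ?_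
        have hset : Ioo 0 t = Iio t ∩ Ioi 0 := by rw [inter_comm, Ioi_inter_Iio]
        rw [hset, ← Measure.restrict_restrict measurableSet_Iio, ← lintegral_const_mul _ hb,
          ← lintegral_indicator measurableSet_Iio]
        rfl
    _ = ∫⁻ s in Ioi (0 : ℝ), ∫⁻ t in Ioi (0 : ℝ),
          {q : ℝ × ℝ | q.2 < q.1}.indicator (fun q => a q.1 * b q.2) (t, s) :=
        lintegral_lintegral_swap hK.aemeasurable
    _ = ∫⁻ s in Ioi (0 : ℝ), b s * ∫⁻ t in Ioi s, a t := by
        refine setLIntegral_congr_fun measurableSet_Ioi fun s hs => ?_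
        have hsub : Ioi s ⊆ Ioi (0 : ℝ) := Ioi_subset_Ioi (le_of_lt hs)
        rw [← Measure.restrict_restrict_of_subset hsub, ← lintegral_const_mul _ ha,
          ← lintegral_indicator (measurableSet_Ioi (a := s))]
        simp only [mul_comm (b s)]
        rfl

/-- For `φ` nondecreasing, concave, continuous with `φ(0) = 0` and a.e. derivative `φ'`,
and every nonincreasing measurable `f : (0,∞) → [0,∞)` (locally integrable so that `S f`
is defined), one has `‖S f‖_{Λ_φ} = ∫₀^∞ f(s)·θ_φ(s) ds` in `[0,∞]`; in particular
`S f ∈ Λ_φ` iff `∫₀^∞ f·θ_φ < ∞`. -/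
theorem lorentzNorm_hardy_of_antitone (φ φ' : ℝ → ℝ)
    (hmono : MonotoneOn φ (Ici 0)) (hconc : ConcaveOn ℝ (Ici 0) φ)
    (hcont : ContinuousOn φ (Ici 0)) (hφ0 : φ 0 = 0)
    (hφ'meas : Measurable φ') (hφ'nn : ∀ t ∈ Ioi (0 : ℝ), 0 ≤ φ' t)
    (hφ'anti : AntitoneOn φ' (Ioi 0))
    (hFTC : ∀ t > (0 : ℝ),
      ENNReal.ofReal (φ t) = ∫⁻ s in Ioo (0 : ℝ) t, ENNReal.ofReal (φ' s))
    (f : ℝ → ℝ) (hfmeas : Measurable f) (hfnn : ∀ x ∈ Ioi (0 : ℝ), 0 ≤ f x)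
    (hfanti : AntitoneOn f (Ioi 0))
    (hfloc : ∀ x > (0 : ℝ), IntegrableOn f (Ioo 0 x)) :
    (lorentzNorm φ (fun x => S f x)
        = ∫⁻ s in Ioi (0 : ℝ), ENNReal.ofReal (f s) * theta φ' s) ∧
    (lorentzNorm φ (fun x => S f x) < ⊤ ↔
        (∫⁻ s in Ioi (0 : ℝ), ENNReal.ofReal (f s) * theta φ' s) < ⊤) := by
  have key : lorentzNorm φ (fun x => S f x)
      = ∫⁻ s in Ioi (0 : ℝ), ENNReal.ofReal (f s) * theta φ' s := by
    rw [lorentzNorm_of_antitoneOn hφ0 hφ'meas hFTC (fun x hx => S_nonneg hfnn hx)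
      (S_antitoneOn hfanti hfloc)]
    simp only [theta]
    have hm : Measurable fun t => φ' t / t := hφ'meas.div measurable_id
    rw [← lintegral_mul_lintegral_Ioo_eq hm.ennreal_ofReal
      hfmeas.ennreal_ofReal]
    refine setLIntegral_congr_fun measurableSet_Ioi fun t ht => ?_
    rw [ofReal_S hfnn hfloc ht, ← mul_assoc, ← ENNReal.ofReal_mul (hφ'nn t ht), mul_one_div]
  exact ⟨key, by rw [key]⟩
end

section
/- Let φ : [0,∞) → [0,∞) be nondecreasing, concave, and continuous with φ(0) = 0, with a.e. derivative φ′, and set θ_φ(y) = ∫_y^∞ φ′(t)/t dt. Then for every measurable f : (0,∞) → ℝ, ∫₀^∞ |f(s)|·θ_φ(s) ds ≤ ‖S|f|‖_{Λ_φ}, as an inequality in [0,∞]. In particular, if S|f| ∈ Λ_φ then f belongs to the weighted space L¹(θ_φ(t) dt); that is, [S, Λ_φ] embeds continuously (with constant 1) into L¹(θ_φ(t) dt). -/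
open MeasureTheory Set
open scoped ENNReal

/-- A nonnegative antitone density integrates less over a set of finite measure `m` than over
the initial interval of length `m`. -/
lemma setLIntegral_le_setLIntegral_Ioo_of_antitoneOn {w : ℝ → ℝ≥0∞}
    (hw : AntitoneOn w (Ioi 0)) {E : Set ℝ} (hE : MeasurableSet E) (hE0 : E ⊆ Ioi 0)
    (hfin : volume E ≠ ⊤) :
    ∫⁻ t in E, w t ≤ ∫⁻ t in Ioo 0 (volume E).toReal, w t := by
  set m := (volume E).toReal with hm
  rcases (ENNReal.toReal_nonneg : 0 ≤ (volume E).toReal).eq_or_lt with h0 | hpos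
  · have : volume E = 0 := by
      rcases (ENNReal.toReal_eq_zero_iff _).1 h0.symm with h | h
      · exact h
      · exact absurd h hfin
    rw [setLIntegral_measure_zero _ _ this]
    exact zero_le
  · have hI : volume (Ioo 0 m) = volume E := by
      rw [Real.volume_Ioo, sub_zero, hm, ENNReal.ofReal_toReal hfin]
    have hdiff : volume (E \ Ioo 0 m) = volume (Ioo 0 m \ E) := by
      have h1 := measure_inter_add_sdiff (μ := volume) E (measurableSet_Ioo (a := 0) (b := m))
      have h2 := measure_inter_add_sdiff (μ := volume) (Ioo 0 m) hE
      rw [inter_comm, hI, ← h1] at h2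
      exact ((ENNReal.add_right_inj (measure_ne_top_of_subset inter_subset_left hfin)).1 h2).symm
    calc ∫⁻ t in E, w t
        = (∫⁻ t in E ∩ Ioo 0 m, w t) + ∫⁻ t in E \ Ioo 0 m, w t :=
          (lintegral_inter_add_sdiff w E measurableSet_Ioo).symm
      _ ≤ (∫⁻ t in E ∩ Ioo 0 m, w t) + ∫⁻ _ in E \ Ioo 0 m, w m := by
          refine add_le_add_right (setLIntegral_mono' (hE.diff measurableSet_Ioo) ?_) _
          intro t ht
          exact hw hpos (hE0 ht.1) (not_lt.1 fun h => ht.2 ⟨hE0 ht.1, h⟩)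
      _ = (∫⁻ t in Ioo 0 m ∩ E, w t) + ∫⁻ _ in Ioo 0 m \ E, w m := by
          rw [setLIntegral_const, setLIntegral_const, hdiff, inter_comm]
      _ ≤ (∫⁻ t in Ioo 0 m ∩ E, w t) + ∫⁻ t in Ioo 0 m \ E, w t := by
          refine add_le_add_right (setLIntegral_mono' (measurableSet_Ioo.diff hE) ?_) _
          intro t ht
          exact hw ht.1.1 hpos ht.1.2.le
      _ = ∫⁻ t in Ioo 0 m, w t := lintegral_inter_add_sdiff w _ hE

lemma setLIntegral_le_PhiE {φ φ' : ℝ → ℝ} (hφ'anti : AntitoneOn φ' (Ioi 0))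
    (hFTC : ∀ t > (0 : ℝ),
      ENNReal.ofReal (φ t) = ∫⁻ s in Ioo (0 : ℝ) t, ENNReal.ofReal (φ' s))
    {E : Set ℝ} (hE : MeasurableSet E) (hE0 : E ⊆ Ioi 0) :
    ∫⁻ t in E, ENNReal.ofReal (φ' t) ≤ PhiE φ (volume E) := by
  unfold PhiE
  split_ifs with htop
  · have hU : (⋃ n : ℕ, Ioo (0 : ℝ) (n + 1)) = Ioi 0 := by
      ext x
      simp only [mem_iUnion, mem_Ioo, mem_Ioi]
      refine ⟨fun ⟨_, h⟩ => h.1, fun h => ?_⟩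
      obtain ⟨n, hn⟩ := exists_nat_gt x
      exact ⟨n, h, by linarith⟩
    have hdir : Directed (· ⊆ ·) fun n : ℕ => Ioo (0 : ℝ) (n + 1) :=
      Monotone.directed_le fun a b hab => Ioo_subset_Ioo_right (by
        have : (a : ℝ) ≤ b := by exact_mod_cast hab
        linarith)
    calc ∫⁻ t in E, ENNReal.ofReal (φ' t)
        ≤ ∫⁻ t in Ioi 0, ENNReal.ofReal (φ' t) := lintegral_mono_set hE0
      _ = ⨆ n : ℕ, ∫⁻ t in Ioo (0 : ℝ) (n + 1), ENNReal.ofReal (φ' t) := by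
          rw [← hU, setLIntegral_iUnion_of_directed _ hdir]
      _ ≤ _ := by
          refine iSup_le fun n => ?_
          have hn : (0 : ℝ) < n + 1 := by positivity
          rw [← hFTC _ hn]
          exact le_iSup₂ (f := fun t (_ : t ∈ Ioi (0 : ℝ)) => ENNReal.ofReal (φ t)) _ hn
  · have hanti : AntitoneOn (fun t => ENNReal.ofReal (φ' t)) (Ioi 0) :=
      fun a ha b hb hab => ENNReal.ofReal_le_ofReal (hφ'anti ha hb hab)
    refine (setLIntegral_le_setLIntegral_Ioo_of_antitoneOn hanti hE hE0 htop).trans ?_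
    rcases (ENNReal.toReal_nonneg : 0 ≤ (volume E).toReal).eq_or_lt with h0 | hpos
    · simp [← h0]
    · exact (hFTC _ hpos).ge

lemma S_abs_nonneg (f : ℝ → ℝ) {x : ℝ} (hx : 0 < x) : 0 ≤ S (fun y => |f y|) x :=
  mul_nonneg (by positivity) (integral_nonneg fun _ => abs_nonneg _)

lemma measurable_S_abs {f : ℝ → ℝ} (hf : Measurable f) :
    Measurable (S fun y => |f y|) := by
  have h : (S fun y => |f y|) =
      fun x => (1 / x) * (∫⁻ y in Ioo (0 : ℝ) x, ENNReal.ofReal |f y|).toReal := by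
    funext x
    rw [S, integral_eq_lintegral_of_nonneg_ae (.of_forall fun _ => abs_nonneg _)
      hf.abs.aestronglyMeasurable]
  have hmono : Monotone fun x : ℝ => ∫⁻ y in Ioo (0 : ℝ) x, ENNReal.ofReal |f y| :=
    fun a b hab => lintegral_mono_set (Ioo_subset_Ioo_right hab)
  rw [h]
  exact (measurable_const.div measurable_id).mul hmono.measurable.ennreal_toReal

lemma ofReal_S_abs {f : ℝ → ℝ} {x : ℝ} (hx : 0 < x) (hf : IntegrableOn f (Ioo 0 x)) :
    ENNReal.ofReal (S (fun y => |f y|) x) =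
      ENNReal.ofReal (1 / x) * ∫⁻ y in Ioo (0 : ℝ) x, ENNReal.ofReal |f y| := by
  rw [S, ENNReal.ofReal_mul (by positivity),
    ofReal_integral_eq_lintegral_ofReal hf.abs (.of_forall fun _ => abs_nonneg _)]

/-- Tonelli: `∫₀^∞ |f| θ_φ = ∫₀^∞ φ' S|f|`. -/
lemma lintegral_abs_mul_theta {φ' f : ℝ → ℝ} (hφ' : Measurable φ')
    (hf : Measurable f) (hfloc : ∀ x > (0 : ℝ), IntegrableOn f (Ioo 0 x)) :
    ∫⁻ s in Ioi (0 : ℝ), ENNReal.ofReal |f s| * theta φ' s =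
      ∫⁻ t in Ioi (0 : ℝ), ENNReal.ofReal (φ' t) * ENNReal.ofReal (S (fun y => |f y|) t) := by
  set K : ℝ → ℝ → ℝ≥0∞ := fun s t =>
    {p : ℝ × ℝ | 0 < p.1 ∧ p.1 < p.2}.indicator
      (fun p => ENNReal.ofReal |f p.1| * ENNReal.ofReal (φ' p.2 / p.2)) (s, t) with hK
  have hset : MeasurableSet {p : ℝ × ℝ | 0 < p.1 ∧ p.1 < p.2} :=
    (measurableSet_lt measurable_const measurable_fst).inter
      (measurableSet_lt measurable_fst measurable_snd)
  have hKm : Measurable (Function.uncurry K) := by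
    refine Measurable.indicator ?_ hset
    fun_prop
  have hdiv : Measurable fun t => ENNReal.ofReal (φ' t / t) := by fun_prop
  have hl : ∫⁻ s in Ioi (0 : ℝ), ENNReal.ofReal |f s| * theta φ' s = ∫⁻ s, ∫⁻ t, K s t := by
    rw [← lintegral_indicator measurableSet_Ioi]
    congr 1 with s
    by_cases hs : 0 < s
    · rw [indicator_of_mem (show s ∈ Ioi 0 from hs), theta, ← lintegral_const_mul _ hdiv,
        ← lintegral_indicator measurableSet_Ioi]
      congr 1 with t
      simp [hK, indicator, hs]
    · simp [hK, indicator, hs]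
  have hr : ∫⁻ t in Ioi (0 : ℝ), ENNReal.ofReal (φ' t) *
      ENNReal.ofReal (S (fun y => |f y|) t) = ∫⁻ t, ∫⁻ s, K s t := by
    rw [← lintegral_indicator measurableSet_Ioi]
    congr 1 with t
    by_cases ht : 0 < t
    · rw [indicator_of_mem (show t ∈ Ioi 0 from ht), ofReal_S_abs ht (hfloc t ht), ← mul_assoc,
        ← ENNReal.ofReal_mul' (by positivity), mul_one_div, mul_comm,
        ← lintegral_mul_const _ (by fun_prop), ← lintegral_indicator measurableSet_Ioo]
      congr 1 with s
    · have : ∀ s, ¬ (0 < s ∧ s < t) := fun s h => ht (h.1.trans h.2)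
      simp [hK, indicator, ht, this]
  rw [hl, hr, lintegral_lintegral_swap hKm.aemeasurable]

/-- For `φ` nondecreasing, concave, continuous with `φ(0) = 0` and a.e. derivative `φ'`,
every measurable (locally integrable) `f : (0,∞) → ℝ` satisfies
`∫₀^∞ |f(s)|·θ_φ(s) ds ≤ ‖S|f|‖_{Λ_φ}` in `[0,∞]`: the optimal domain `[S, Λ_φ]` embeds
with constant 1 into the weighted space `L¹(θ_φ(t) dt)`. -/
theorem hardy_domain_subset_weighted_L1 (φ φ' : ℝ → ℝ)
    (hmono : MonotoneOn φ (Ici 0)) (hconc : ConcaveOn ℝ (Ici 0) φ)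
    (hcont : ContinuousOn φ (Ici 0)) (hφ0 : φ 0 = 0)
    (hφ'meas : Measurable φ') (hφ'nn : ∀ t ∈ Ioi (0 : ℝ), 0 ≤ φ' t)
    (hφ'anti : AntitoneOn φ' (Ioi 0))
    (hFTC : ∀ t > (0 : ℝ),
      ENNReal.ofReal (φ t) = ∫⁻ s in Ioo (0 : ℝ) t, ENNReal.ofReal (φ' s))
    (f : ℝ → ℝ) (hfmeas : Measurable f)
    (hfloc : ∀ x > (0 : ℝ), IntegrableOn f (Ioo 0 x)) :
    (∫⁻ s in Ioi (0 : ℝ), ENNReal.ofReal |f s| * theta φ' s)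
      ≤ lorentzNorm φ (fun x => S (fun y => |f y|) x) := by
  set g : ℝ → ℝ := S fun y => |f y| with hg
  have hgm : Measurable g := measurable_S_abs hfmeas
  have hφm : Measurable fun t => ENNReal.ofReal (φ' t) := hφ'meas.ennreal_ofReal
  set μ : Measure ℝ := (volume.restrict (Ioi 0)).withDensity fun t => ENNReal.ofReal (φ' t)
    with hμ
  have hgnn : 0 ≤ᵐ[μ] g :=
    (withDensity_absolutelyContinuous _ _).ae_le
      ((ae_restrict_mem measurableSet_Ioi).mono fun x hx => S_abs_nonneg f hx)
  have hlayer : ∫⁻ t in Ioi (0 : ℝ), ENNReal.ofReal (φ' t) * ENNReal.ofReal (g t) =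
      ∫⁻ s in Ioi (0 : ℝ), μ {t | s < g t} := by
    rw [← lintegral_eq_lintegral_meas_lt μ hgnn hgm.aemeasurable, hμ,
      lintegral_withDensity_eq_lintegral_mul _ hφm hgm.ennreal_ofReal]
    rfl
  rw [lintegral_abs_mul_theta hφ'meas hfmeas hfloc, hlayer]
  refine lintegral_mono fun s => ?_
  have hEm : MeasurableSet {t | t ∈ Ioi (0 : ℝ) ∧ s < |g t|} :=
    measurableSet_Ioi.inter (measurableSet_lt measurable_const hgm.abs)
  have hlt : MeasurableSet {t | s < g t} := measurableSet_lt measurable_const hgm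
  rw [hμ, withDensity_apply _ hlt, Measure.restrict_restrict hlt]
  refine (lintegral_mono_set ?_).trans (setLIntegral_le_PhiE hφ'anti hFTC hEm fun _ h => h.1)
  exact fun t ht => ⟨ht.2, ht.1.trans_le (le_abs_self _)⟩
end

section
/- Let φ : [0,∞) → [0,∞) be nondecreasing, concave, and continuous with φ(0) = 0, with a.e. derivative φ′, and set θ_φ(y) = ∫_y^∞ φ′(t)/t dt. Then for every t > 0, (1/2)·(θ_φ(t) + φ(t)/t) ≤ ∫₀^∞ φ′(s)/(t+s) ds ≤ θ_φ(t) + φ(t)/t, as inequalities in [0,∞]. In other words, the function φ_{Λ_φ}(t) := ∫₀^∞ φ′(s)/(t+s) ds is equivalent to θ_φ(t) + φ(t)/t. -/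
open MeasureTheory Set
open scoped ENNReal

/-- Pulling the constant `1 / t` into the integral expressing `φ t`. -/
theorem ofReal_div_eq_setLIntegral {φ φ' : ℝ → ℝ} {t : ℝ} (ht : 0 < t) (hmeas : Measurable φ')
    (hFTC : ENNReal.ofReal (φ t) = ∫⁻ s in Ioo (0 : ℝ) t, ENNReal.ofReal (φ' s)) :
    ENNReal.ofReal (φ t / t) = ∫⁻ s in Ioc (0 : ℝ) t, ENNReal.ofReal (φ' s / t) := by
  simp_rw [ENNReal.ofReal_div_of_pos ht, div_eq_mul_inv]
  rw [lintegral_mul_const _ hmeas.ennreal_ofReal, hFTC, setLIntegral_congr Ioo_ae_eq_Ioc]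

/-- Halving commutes with the lower integral of the positive part of a real function. -/
theorem setLIntegral_ofReal_div_two {f : ℝ → ℝ} (hf : Measurable f) (A : Set ℝ) :
    (∫⁻ s in A, ENNReal.ofReal (f s)) / 2 = ∫⁻ s in A, ENNReal.ofReal (f s / 2) := by
  simp_rw [ENNReal.ofReal_div_of_pos (zero_lt_two' ℝ), div_eq_mul_inv]
  rw [lintegral_mul_const _ hf.ennreal_ofReal, ENNReal.ofReal_ofNat]

/-- For `φ` nondecreasing, concave, continuous with `φ(0) = 0` and a.e. derivative `φ'`,
and every `t > 0`:
`(1/2)·(θ_φ(t) + φ(t)/t) ≤ ∫₀^∞ φ'(s)/(t+s) ds ≤ θ_φ(t) + φ(t)/t` in `[0,∞]`;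
that is, `φ_{Λ_φ}(t) = ∫₀^∞ φ'(s)/(t+s) ds` is equivalent to `θ_φ(t) + φ(t)/t`. -/
theorem phiLambda_equiv_theta_add_phi_div (φ φ' : ℝ → ℝ)
    (hmono : MonotoneOn φ (Ici 0)) (hconc : ConcaveOn ℝ (Ici 0) φ)
    (hcont : ContinuousOn φ (Ici 0)) (hφ0 : φ 0 = 0)
    (hφ'meas : Measurable φ') (hφ'nn : ∀ t ∈ Ioi (0 : ℝ), 0 ≤ φ' t)
    (hφ'anti : AntitoneOn φ' (Ioi 0))
    (hFTC : ∀ t > (0 : ℝ),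
      ENNReal.ofReal (φ t) = ∫⁻ s in Ioo (0 : ℝ) t, ENNReal.ofReal (φ' s)) :
    ∀ t > (0 : ℝ),
      (theta φ' t + ENNReal.ofReal (φ t / t)) / 2
          ≤ (∫⁻ s in Ioi (0 : ℝ), ENNReal.ofReal (φ' s / (t + s))) ∧
      (∫⁻ s in Ioi (0 : ℝ), ENNReal.ofReal (φ' s / (t + s)))
          ≤ theta φ' t + ENNReal.ofReal (φ t / t) := by
  intro t ht
  rw [ofReal_div_eq_setLIntegral ht hφ'meas (hFTC t ht), theta, ← Ioc_union_Ioi_eq_Ioi ht.le,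
    lintegral_union measurableSet_Ioi Ioc_disjoint_Ioi_same, add_comm (∫⁻ s in Ioi t, _)]
  constructor
  · rw [ENNReal.add_div, setLIntegral_ofReal_div_two (by fun_prop),
      setLIntegral_ofReal_div_two (by fun_prop)]
    refine add_le_add (setLIntegral_mono' measurableSet_Ioc fun s hs ↦ ?_)
      (setLIntegral_mono' measurableSet_Ioi fun s hs ↦ ?_)
    · have hs0 : 0 < s := hs.1
      rw [div_div]
      exact ENNReal.ofReal_le_ofReal <|
        div_le_div_of_nonneg_left (hφ'nn s hs0) (by positivity) (by linarith [hs.2])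
    · have hts : t < s := hs
      have hs0 : 0 < s := ht.trans hts
      rw [div_div]
      exact ENNReal.ofReal_le_ofReal <|
        div_le_div_of_nonneg_left (hφ'nn s hs0) (by positivity) (by linarith)
  · refine add_le_add (setLIntegral_mono' measurableSet_Ioc fun s hs ↦ ?_)
      (setLIntegral_mono' measurableSet_Ioi fun s hs ↦ ?_)
    · exact ENNReal.ofReal_le_ofReal <|
        div_le_div_of_nonneg_left (hφ'nn s hs.1) ht (by linarith [hs.1])
    · have hs0 : 0 < s := ht.trans hs
      exact ENNReal.ofReal_le_ofReal <|
        div_le_div_of_nonneg_left (hφ'nn s hs0) hs0 (by linarith)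
end

section
/- Let φ : [0,∞) → [0,∞) be nondecreasing, concave, and continuous with φ(0) = 0, with a.e. derivative φ′, assume θ_φ(y) = ∫_y^∞ φ′(t)/t dt < ∞ for every y > 0, and assume there is a constant C > 0 such that φ(t)/t ≤ C·θ_φ(t) for all t > 0. Then for every measurable f : (0,∞) → ℝ: S|f| ∈ Λ_φ if and only if ∫₀^∞ |f(t)|·θ_φ(t) dt < ∞; moreover, ∫₀^∞ |f(t)|·θ_φ(t) dt ≤ ‖S|f|‖_{Λ_φ} ≤ (1 + C)·∫₀^∞ |f(t)|·θ_φ(t) dt. That is, the optimal domain [S, Λ_φ] equals the weighted space L¹(θ_φ(t) dt) with equivalent norms. -/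
open MeasureTheory Set
open scoped ENNReal

/-- Lebesgue measure on the half-line `(0,∞)`. -/
noncomputable abbrev halfLine : Measure ℝ := volume.restrict (Ioi (0 : ℝ))

lemma measurableSet_ofReal_lt (a : ℝ≥0∞) : MeasurableSet {s : ℝ | ENNReal.ofReal s < a} :=
  measurableSet_lt ENNReal.measurable_ofReal measurable_const

lemma setOf_ofReal_lt_inter_Ioi {a : ℝ≥0∞} (ha : a ≠ ⊤) :
    {s : ℝ | ENNReal.ofReal s < a} ∩ Ioi 0 = Ioo 0 a.toReal := by
  ext s
  simp only [mem_inter_iff, mem_ofPred_eq, mem_Ioi, mem_Ioo]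
  rw [and_comm]
  exact and_congr_right fun hs => ENNReal.ofReal_lt_iff_lt_toReal (le_of_lt hs) ha

lemma halfLine_ofReal_lt (a : ℝ≥0∞) : halfLine {s : ℝ | ENNReal.ofReal s < a} = a := by
  rw [Measure.restrict_apply (measurableSet_ofReal_lt a)]
  rcases eq_or_ne a ⊤ with rfl | ha
  · simp
  · rw [setOf_ofReal_lt_inter_Ioi ha, Real.volume_Ioo, sub_zero, ENNReal.ofReal_toReal ha]

lemma halfLine_diff_le (a c : ℝ≥0∞) :
    halfLine {s : ℝ | c ≤ ENNReal.ofReal s ∧ ENNReal.ofReal s < a} ≤ a - c := by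
  rcases lt_or_ge a c with hac | hac
  · have : {s : ℝ | c ≤ ENNReal.ofReal s ∧ ENNReal.ofReal s < a} = ∅ := by
      ext s
      simp only [mem_ofPred_eq, mem_empty_iff_false, iff_false, not_and, not_lt]
      exact fun h => hac.le.trans h
    simp [this]
  rcases eq_or_ne c ⊤ with rfl | hc
  · simp
  have : {s : ℝ | c ≤ ENNReal.ofReal s ∧ ENNReal.ofReal s < a}
      = {s : ℝ | ENNReal.ofReal s < a} \ {s : ℝ | ENNReal.ofReal s < c} := by
    ext s
    simp [and_comm]
  have hsub : {s : ℝ | ENNReal.ofReal s < c} ⊆ {s : ℝ | ENNReal.ofReal s < a} :=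
    fun s (hs : ENNReal.ofReal s < c) => hs.trans_le hac
  rw [this, measure_sdiff hsub
    (measurableSet_ofReal_lt c).nullMeasurableSet (by rwa [halfLine_ofReal_lt]),
    halfLine_ofReal_lt, halfLine_ofReal_lt]

/-- The distribution function of an extended nonnegative function on the half-line. -/
noncomputable def levelMeasure (G : ℝ → ℝ≥0∞) (s : ℝ) : ℝ≥0∞ :=
  halfLine {x | ENNReal.ofReal s < G x}

lemma measurable_levelMeasure (G : ℝ → ℝ≥0∞) : Measurable (levelMeasure G) := by
  refine Antitone.measurable fun s t hst => measure_mono fun x hx => ?_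
  exact lt_of_le_of_lt (ENNReal.ofReal_le_ofReal hst) hx

lemma measurableSet_ofReal_lt_comp {G : ℝ → ℝ≥0∞} (hG : Measurable G) :
    MeasurableSet {p : ℝ × ℝ | ENNReal.ofReal p.1 < G p.2} :=
  measurableSet_lt (ENNReal.measurable_ofReal.comp measurable_fst) (hG.comp measurable_snd)

/-- The layer cake formula with a weight. -/
lemma lintegral_mul_eq_lintegral_levelSet {G w : ℝ → ℝ≥0∞} (hG : Measurable G)
    (hw : Measurable w) :
    ∫⁻ x, G x * w x ∂halfLine
      = ∫⁻ s, ∫⁻ x, {x | ENNReal.ofReal s < G x}.indicator w x ∂halfLine ∂halfLine := by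
  rw [lintegral_lintegral_swap]
  · refine lintegral_congr fun x => ?_
    have : ∀ s : ℝ, {x | ENNReal.ofReal s < G x}.indicator w x
        = {s : ℝ | ENNReal.ofReal s < G x}.indicator (fun _ => w x) s := fun s => by
      simp [indicator]
    simp_rw [this]
    rw [lintegral_indicator_const (measurableSet_ofReal_lt _), halfLine_ofReal_lt, mul_comm]
  · exact ((hw.comp measurable_snd).indicator (measurableSet_ofReal_lt_comp hG)).aemeasurable

lemma lintegral_min_levelMeasure_le {G : ℝ → ℝ≥0∞} (hG : Measurable G) (c d : ℝ≥0∞) :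
    ∫⁻ s, min (levelMeasure G s) d ∂halfLine ≤ c * d + ∫⁻ x, (G x - c) ∂halfLine := by
  have hmeas : MeasurableSet {p : ℝ × ℝ | c ≤ ENNReal.ofReal p.1 ∧ ENNReal.ofReal p.1 < G p.2} :=
    (measurableSet_le measurable_const (ENNReal.measurable_ofReal.comp measurable_fst)).inter
      (measurableSet_ofReal_lt_comp hG)
  have hsec : ∀ s : ℝ, MeasurableSet {x | c ≤ ENNReal.ofReal s ∧ ENNReal.ofReal s < G x} :=
    fun s => measurable_prodMk_left hmeas
  have hsec' : ∀ x : ℝ, MeasurableSet {s : ℝ | c ≤ ENNReal.ofReal s ∧ ENNReal.ofReal s < G x} :=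
    fun x => measurable_prodMk_right hmeas
  calc ∫⁻ s, min (levelMeasure G s) d ∂halfLine
      ≤ ∫⁻ s, ({s : ℝ | ENNReal.ofReal s < c}.indicator (fun _ => d) s
          + ∫⁻ x, {x | c ≤ ENNReal.ofReal s ∧ ENNReal.ofReal s < G x}.indicator 1 x
            ∂halfLine) ∂halfLine := by
        refine lintegral_mono fun s => ?_
        rw [lintegral_indicator_one (hsec s)]
        rcases lt_or_ge (ENNReal.ofReal s) c with h | h
        · simp [h]
        · simp [h, levelMeasure]
    _ = c * d + ∫⁻ s, ∫⁻ x, {x | c ≤ ENNReal.ofReal s ∧ ENNReal.ofReal s < G x}.indicator 1 x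
            ∂halfLine ∂halfLine := by
        rw [lintegral_add_left (measurable_const.indicator (measurableSet_ofReal_lt c)),
          lintegral_indicator_const (measurableSet_ofReal_lt _), halfLine_ofReal_lt, mul_comm]
    _ ≤ c * d + ∫⁻ x, (G x - c) ∂halfLine := by
        refine add_le_add_right ?_ _
        rw [lintegral_lintegral_swap]
        · refine lintegral_mono fun x => ?_
          have : ∀ s : ℝ,
              {x | c ≤ ENNReal.ofReal s ∧ ENNReal.ofReal s < G x}.indicator (1 : ℝ → ℝ≥0∞) x
              = {s : ℝ | c ≤ ENNReal.ofReal s ∧ ENNReal.ofReal s < G x}.indicator 1 s :=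
            fun s => by simp [indicator]
          simp_rw [this]
          rw [lintegral_indicator_one (hsec' x)]
          exact halfLine_diff_le _ _
        · exact ((measurable_const (a := (1 : ℝ≥0∞))).indicator hmeas).aemeasurable

/-- The kernel of the Hardy operator. -/
noncomputable def hardyKernel (x y : ℝ) : ℝ≥0∞ := if y < x then (ENNReal.ofReal x)⁻¹ else 0

lemma measurable_hardyKernel : Measurable fun p : ℝ × ℝ => hardyKernel p.1 p.2 :=
  Measurable.ite (measurableSet_lt measurable_snd measurable_fst)
    (ENNReal.measurable_ofReal.comp measurable_fst).inv measurable_const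

/-- The Hardy operator on extended nonnegative functions. -/
noncomputable def hardyE (F : ℝ → ℝ≥0∞) (x : ℝ) : ℝ≥0∞ :=
  ∫⁻ y, F y * hardyKernel x y ∂halfLine

lemma measurable_hardyE {F : ℝ → ℝ≥0∞} (hF : Measurable F) : Measurable (hardyE F) :=
  Measurable.lintegral_prod_right ((hF.comp measurable_snd).mul measurable_hardyKernel)

lemma lintegral_hardyKernel_sub (y : ℝ) (hy : 0 < y) (c : ℝ≥0∞) :
    ∫⁻ x, (hardyKernel x y - c) ∂halfLine
      = ∫⁻ r, ((ENNReal.ofReal y + ENNReal.ofReal r)⁻¹ - c) ∂halfLine := by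
  have h1 : ∫⁻ x, (hardyKernel x y - c) ∂halfLine
      = ∫⁻ x, (Ioi y).indicator (fun x => (ENNReal.ofReal x)⁻¹ - c) x := by
    rw [← lintegral_indicator measurableSet_Ioi]
    refine lintegral_congr fun x => ?_
    by_cases hx : y < x
    · simp [hardyKernel, hx, hy.trans hx]
    · simp [hardyKernel, hx, indicator]
  rw [h1, ← lintegral_add_left_eq_self _ y, ← lintegral_indicator measurableSet_Ioi]
  refine lintegral_congr fun r => ?_
  by_cases hr : 0 < r
  · simp [hr, ENNReal.ofReal_add hy.le hr.le]
  · simp [hr]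

lemma mul_add_lintegral_hardyKernel_sub_le (y : ℝ) (hy : 0 < y) (d : ℝ≥0∞) :
    (d + ENNReal.ofReal y)⁻¹ * d
        + ∫⁻ x, (hardyKernel x y - (d + ENNReal.ofReal y)⁻¹) ∂halfLine
      ≤ ∫⁻ r, {r : ℝ | ENNReal.ofReal r < d}.indicator
          (fun r => (ENNReal.ofReal y + ENNReal.ofReal r)⁻¹) r ∂halfLine := by
  have h : (d + ENNReal.ofReal y)⁻¹ * d = ∫⁻ r, {r : ℝ | ENNReal.ofReal r < d}.indicator
      (fun _ => (d + ENNReal.ofReal y)⁻¹) r ∂halfLine := by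
    rw [lintegral_indicator_const (measurableSet_ofReal_lt _), halfLine_ofReal_lt]
  rw [lintegral_hardyKernel_sub y hy, h,
    ← lintegral_add_left (measurable_const.indicator (measurableSet_ofReal_lt d))]
  refine lintegral_mono fun r => ?_
  rcases lt_or_ge (ENNReal.ofReal r) d with hr | hr
  · simp only [mem_ofPred_eq, hr, indicator_of_mem]
    rw [add_tsub_cancel_of_le]
    rw [ENNReal.inv_le_inv, add_comm d]
    gcongr
  · have : (ENNReal.ofReal y + ENNReal.ofReal r)⁻¹ ≤ (d + ENNReal.ofReal y)⁻¹ := by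
      rw [ENNReal.inv_le_inv, add_comm d]
      gcongr
    simp [hr.not_gt, tsub_eq_zero_of_le this]

lemma lintegral_min_levelMeasure_hardyE_le {F : ℝ → ℝ≥0∞} (hF : Measurable F)
    (hFtop : ∀ y, F y ≠ ⊤) (d : ℝ≥0∞) :
    ∫⁻ s, min (levelMeasure (hardyE F) s) d ∂halfLine
      ≤ ∫⁻ y, F y * ∫⁻ r, {r : ℝ | ENNReal.ofReal r < d}.indicator
          (fun r => (ENNReal.ofReal y + ENNReal.ofReal r)⁻¹) r ∂halfLine ∂halfLine := by
  have hcm : Measurable fun y : ℝ => (d + ENNReal.ofReal y)⁻¹ :=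
    (measurable_const.add ENNReal.measurable_ofReal).inv
  have hFcm : Measurable fun y : ℝ => F y * (d + ENNReal.ofReal y)⁻¹ := hF.mul hcm
  have hkm : Measurable fun p : ℝ × ℝ => hardyKernel p.1 p.2 - (d + ENNReal.ofReal p.2)⁻¹ :=
    measurable_hardyKernel.sub (hcm.comp measurable_snd)
  refine (lintegral_min_levelMeasure_le (measurable_hardyE hF)
    (∫⁻ y, F y * (d + ENNReal.ofReal y)⁻¹ ∂halfLine) d).trans ?_
  have hsub : ∫⁻ x, (hardyE F x - ∫⁻ y, F y * (d + ENNReal.ofReal y)⁻¹ ∂halfLine) ∂halfLine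
      ≤ ∫⁻ y, F y * ∫⁻ x, (hardyKernel x y - (d + ENNReal.ofReal y)⁻¹) ∂halfLine ∂halfLine := by
    calc _ ≤ ∫⁻ x, ∫⁻ y, F y * (hardyKernel x y - (d + ENNReal.ofReal y)⁻¹)
          ∂halfLine ∂halfLine := by
          refine lintegral_mono fun x => ?_
          refine (lintegral_sub_le _ _ hFcm).trans_eq (lintegral_congr fun y => ?_)
          rw [ENNReal.mul_sub fun _ _ => hFtop y]
      _ = _ := by
          rw [lintegral_lintegral_swap]
          · refine lintegral_congr fun y => ?_
            rw [lintegral_const_mul]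
            exact hkm.comp measurable_prodMk_right
          · exact ((hF.comp measurable_snd).mul hkm).aemeasurable
  rw [← lintegral_mul_const _ hFcm]
  refine (add_le_add_right hsub _).trans ?_
  rw [← lintegral_add_left (hFcm.mul_const d)]
  refine setLIntegral_mono' measurableSet_Ioi fun y hy => ?_
  rw [mul_assoc, ← mul_add]
  gcongr
  exact mul_add_lintegral_hardyKernel_sub_le y hy d

lemma PhiE_eq_lintegral {φ φ' : ℝ → ℝ} (hφ0 : φ 0 = 0)
    (hFTC : ∀ t > (0 : ℝ),
      ENNReal.ofReal (φ t) = ∫⁻ s in Ioo (0 : ℝ) t, ENNReal.ofReal (φ' s)) (m : ℝ≥0∞) :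
    PhiE φ m = ∫⁻ t, {t : ℝ | ENNReal.ofReal t < m}.indicator
      (fun t => ENNReal.ofReal (φ' t)) t ∂halfLine := by
  rw [lintegral_indicator (measurableSet_ofReal_lt m),
    Measure.restrict_restrict (measurableSet_ofReal_lt m)]
  unfold PhiE
  split_ifs with hm
  · subst hm
    have hU : {t : ℝ | ENNReal.ofReal t < ⊤} ∩ Ioi 0 = ⋃ n : ℕ, Ioo (0 : ℝ) (n + 1) := by
      ext t
      simp only [ENNReal.ofReal_lt_top, ofPred_true, univ_inter, mem_Ioi, mem_iUnion, mem_Ioo]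
      constructor
      · intro h
        obtain ⟨n, hn⟩ := exists_nat_gt t
        exact ⟨n, h, by linarith⟩
      · rintro ⟨n, h, -⟩
        exact h
    apply le_antisymm
    · refine iSup₂_le fun t ht => ?_
      rw [hFTC t ht]
      refine lintegral_mono_set fun x hx => ?_
      simpa using hx.1
    · rw [hU, setLIntegral_iUnion_of_directed]
      · refine iSup_le fun n => ?_
        have hn : (0 : ℝ) < n + 1 := by positivity
        rw [← hFTC _ hn]
        exact le_iSup₂ (f := fun (t : ℝ) (_ : t ∈ Ioi (0 : ℝ)) => ENNReal.ofReal (φ t)) _ hn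
      · refine (monotone_nat_of_le_succ fun n => ?_).directed_le
        refine Ioo_subset_Ioo_right ?_
        push_cast
        linarith
  · rw [setOf_ofReal_lt_inter_Ioi hm]
    rcases eq_or_lt_of_le (ENNReal.toReal_nonneg (a := m)) with h | h
    · simp [← h, hφ0]
    · exact hFTC _ h

/-- The initial interval `{t | t < m}` and a superlevel set of a decreasing function are nested. -/
lemma halfLine_inter_superlevel {A : ℝ → ℝ≥0∞} (hA : AntitoneOn A (Ioi 0)) (m : ℝ≥0∞) (u : ℝ) :
    min m (levelMeasure A u)
      ≤ halfLine ({t | ENNReal.ofReal u < A t} ∩ {t : ℝ | ENNReal.ofReal t < m}) := by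
  have hae : ∀ᵐ t ∂halfLine, t ∈ Ioi (0 : ℝ) := ae_restrict_mem measurableSet_Ioi
  by_cases h : ∃ t ∈ Ioi (0 : ℝ), ENNReal.ofReal t < m ∧ A t ≤ ENNReal.ofReal u
  · obtain ⟨t, ht, htm, htA⟩ := h
    refine (min_le_right _ _).trans (measure_mono_ae ?_)
    filter_upwards [hae] with x hx hxA
    refine ⟨hxA, lt_of_le_of_lt (ENNReal.ofReal_le_ofReal ?_) htm⟩
    by_contra! hlt
    exact absurd hxA (not_lt.2 ((hA ht hx hlt.le).trans htA))
  · push Not at h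
    refine (min_le_left _ _).trans ?_
    conv_lhs => rw [← halfLine_ofReal_lt m]
    refine measure_mono_ae ?_
    filter_upwards [hae] with x hx hxm
    exact ⟨h x hx hxm, hxm⟩

lemma lintegral_indicator_eq_lintegral_inter {A : ℝ → ℝ≥0∞} (hAm : Measurable A) {E : Set ℝ}
    (hE : MeasurableSet E) :
    ∫⁻ x, E.indicator A x ∂halfLine
      = ∫⁻ u, halfLine ({t | ENNReal.ofReal u < A t} ∩ E) ∂halfLine := by
  have h := lintegral_mul_eq_lintegral_levelSet hAm
    ((measurable_const (a := (1 : ℝ≥0∞))).indicator hE)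
  have h1 : ∀ x, A x * E.indicator (fun _ => (1 : ℝ≥0∞)) x = E.indicator A x := fun x => by
    by_cases hx : x ∈ E <;> simp [hx]
  simp_rw [h1] at h
  rw [h]
  refine lintegral_congr fun u => ?_
  have hu : MeasurableSet {t | ENNReal.ofReal u < A t} := measurableSet_lt measurable_const hAm
  rw [indicator_indicator]
  exact lintegral_indicator_one (hu.inter hE)

lemma lintegral_indicator_initial_eq {A : ℝ → ℝ≥0∞} (hAm : Measurable A)
    (hA : AntitoneOn A (Ioi 0)) (m : ℝ≥0∞) :
    ∫⁻ t, {t : ℝ | ENNReal.ofReal t < m}.indicator A t ∂halfLine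
      = ∫⁻ u, min m (levelMeasure A u) ∂halfLine := by
  rw [lintegral_indicator_eq_lintegral_inter hAm (measurableSet_ofReal_lt m)]
  refine lintegral_congr fun u => le_antisymm (le_min ?_ ?_) (halfLine_inter_superlevel hA m u)
  · exact (measure_mono inter_subset_right).trans_eq (halfLine_ofReal_lt m)
  · exact measure_mono inter_subset_left

/-- Hardy–Littlewood: a decreasing function has its largest integral on initial intervals. -/
lemma lintegral_indicator_le_initial {A : ℝ → ℝ≥0∞} (hAm : Measurable A)
    (hA : AntitoneOn A (Ioi 0)) {E : Set ℝ} (hE : MeasurableSet E) :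
    ∫⁻ x, E.indicator A x ∂halfLine
      ≤ ∫⁻ t, {t : ℝ | ENNReal.ofReal t < halfLine E}.indicator A t ∂halfLine := by
  rw [lintegral_indicator_initial_eq hAm hA, lintegral_indicator_eq_lintegral_inter hAm hE]
  exact lintegral_mono fun u =>
    le_min (measure_mono inter_subset_right) (measure_mono inter_subset_left)

lemma lintegral_superlevel_kernel_le {A : ℝ → ℝ≥0∞} (hA : AntitoneOn A (Ioi 0))
    {k : ℝ → ℝ≥0∞} (hk : Measurable k) :
    ∫⁻ u, ∫⁻ r, {r : ℝ | ENNReal.ofReal r < levelMeasure A u}.indicator k r ∂halfLine ∂halfLine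
      ≤ ∫⁻ r, A r * k r ∂halfLine := by
  have hm : MeasurableSet {p : ℝ × ℝ | ENNReal.ofReal p.2 < levelMeasure A p.1} :=
    measurableSet_lt (ENNReal.measurable_ofReal.comp measurable_snd)
      ((measurable_levelMeasure A).comp measurable_fst)
  have hkm : Measurable fun p : ℝ × ℝ =>
      {r : ℝ | ENNReal.ofReal r < levelMeasure A p.1}.indicator k p.2 :=
    (hk.comp measurable_snd).indicator hm
  rw [lintegral_lintegral_swap hkm.aemeasurable]
  refine setLIntegral_mono' measurableSet_Ioi fun r hr => ?_
  rw [mul_comm]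
  conv_rhs => rw [← halfLine_ofReal_lt (A r)]
  rw [← lintegral_indicator_const (measurableSet_ofReal_lt _)]
  refine lintegral_mono fun u => ?_
  by_cases hu : ENNReal.ofReal u < A r
  · simp only [mem_ofPred_eq, hu, indicator_of_mem]
    exact indicator_le_self _ _ _
  · have hle : levelMeasure A u ≤ ENNReal.ofReal r := by
      conv_rhs => rw [← halfLine_ofReal_lt (ENNReal.ofReal r)]
      refine measure_mono_ae ?_
      filter_upwards [ae_restrict_mem measurableSet_Ioi] with x hx hxA
      refine (ENNReal.ofReal_lt_ofReal_iff hr).2 ?_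
      by_contra! hlt
      exact hu (lt_of_lt_of_le hxA (hA hr hx hlt))
    simp [hle.not_gt]

lemma lintegral_mul_inv_add_le {φ φ' : ℝ → ℝ} (hφ'meas : Measurable φ')
    (hFTC : ∀ t > (0 : ℝ),
      ENNReal.ofReal (φ t) = ∫⁻ s in Ioo (0 : ℝ) t, ENNReal.ofReal (φ' s))
    {y : ℝ} (hy : 0 < y) :
    ∫⁻ r, ENNReal.ofReal (φ' r) * (ENNReal.ofReal y + ENNReal.ofReal r)⁻¹ ∂halfLine
      ≤ ENNReal.ofReal (φ y / y) + theta φ' y := by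
  rw [halfLine, ← Ioc_union_Ioi_eq_Ioi hy.le]
  refine (lintegral_union_le _ _ _).trans (add_le_add ?_ ?_)
  · rw [ENNReal.ofReal_div_of_pos hy, hFTC y hy, ENNReal.div_eq_inv_mul, mul_comm,
      ← lintegral_mul_const _ hφ'meas.ennreal_ofReal, setLIntegral_congr Ioo_ae_eq_Ioc]
    gcongr
    exact le_self_add
  · refine setLIntegral_mono' measurableSet_Ioi fun r hr => ?_
    rw [ENNReal.ofReal_div_of_pos (hy.trans hr), div_eq_mul_inv]
    gcongr
    exact le_add_self

lemma hardyE_ofReal_abs {f : ℝ → ℝ} (hfloc : ∀ x > (0 : ℝ), IntegrableOn f (Ioo 0 x))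
    {x : ℝ} (hx : 0 < x) :
    hardyE (fun y => ENNReal.ofReal |f y|) x = ENNReal.ofReal |S (fun y => |f y|) x| := by
  have h0 : 0 ≤ ∫ y in Ioo (0 : ℝ) x, |f y| := integral_nonneg fun _ => abs_nonneg _
  rw [S, abs_of_nonneg (by positivity), mul_comm, ENNReal.ofReal_mul h0,
    ofReal_integral_eq_lintegral_ofReal (hfloc x hx).abs (ae_of_all _ fun _ => abs_nonneg _),
    one_div, ENNReal.ofReal_inv_of_pos hx, ← lintegral_mul_const' _ _ (by simp [hx]), hardyE,
    ← lintegral_indicator measurableSet_Ioo, ← lintegral_indicator measurableSet_Ioi]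
  refine lintegral_congr fun y => ?_
  by_cases h1 : 0 < y <;> by_cases h2 : y < x <;> simp [hardyKernel, h1, h2]

lemma distFn_eq_levelMeasure {f : ℝ → ℝ} (hfmeas : Measurable f)
    (hfloc : ∀ x > (0 : ℝ), IntegrableOn f (Ioo 0 x)) {s : ℝ} (hs : 0 < s) :
    distFn (fun x => S (fun y => |f y|) x) s
      = levelMeasure (hardyE fun y => ENNReal.ofReal |f y|) s := by
  have hF : Measurable fun y => ENNReal.ofReal |f y| := hfmeas.abs.ennreal_ofReal
  rw [levelMeasure, Measure.restrict_apply
    (measurableSet_lt measurable_const (measurable_hardyE hF)), distFn]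
  congr 1
  ext x
  simp only [mem_Ioi, mem_ofPred_eq, mem_inter_iff]
  rw [and_comm]
  refine and_congr_left fun hx => ?_
  rw [hardyE_ofReal_abs hfloc hx, ENNReal.ofReal_lt_ofReal_iff_of_nonneg hs.le]

lemma lintegral_hardyE_mul {φ' : ℝ → ℝ} (hφ'meas : Measurable φ') {F : ℝ → ℝ≥0∞}
    (hF : Measurable F) :
    ∫⁻ x, hardyE F x * ENNReal.ofReal (φ' x) ∂halfLine = ∫⁻ y, F y * theta φ' y ∂halfLine := by
  have hm : Measurable fun p : ℝ × ℝ =>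
      F p.2 * hardyKernel p.1 p.2 * ENNReal.ofReal (φ' p.1) :=
    ((hF.comp measurable_snd).mul measurable_hardyKernel).mul
      (hφ'meas.comp measurable_fst).ennreal_ofReal
  have h1 : ∀ x, hardyE F x * ENNReal.ofReal (φ' x)
      = ∫⁻ y, F y * hardyKernel x y * ENNReal.ofReal (φ' x) ∂halfLine := fun x => by
    rw [hardyE, lintegral_mul_const' _ _ ENNReal.ofReal_ne_top]
  simp_rw [h1]
  rw [lintegral_lintegral_swap hm.aemeasurable]
  refine setLIntegral_congr_fun measurableSet_Ioi fun y hy => ?_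
  have hy : 0 < y := hy
  simp_rw [mul_assoc]
  have hkm : Measurable fun x => hardyKernel x y * ENNReal.ofReal (φ' x) :=
    (measurable_hardyKernel.comp measurable_prodMk_right).mul hφ'meas.ennreal_ofReal
  rw [lintegral_const_mul _ hkm, theta, ← lintegral_indicator measurableSet_Ioi,
    ← lintegral_indicator measurableSet_Ioi]
  congr 1
  refine lintegral_congr fun x => ?_
  by_cases h : y < x
  · have hx : 0 < x := hy.trans h
    rw [indicator_of_mem (mem_Ioi.2 hx), indicator_of_mem (mem_Ioi.2 h), hardyKernel, if_pos h,
      ENNReal.ofReal_div_of_pos hx, div_eq_mul_inv, mul_comm]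
  · simp [hardyKernel, h, indicator]

/-- For `φ` nondecreasing, concave, continuous, `φ(0) = 0`, a.e. derivative `φ'`, `θ_φ`
finite, and `φ(t)/t ≤ C·θ_φ(t)`: for every measurable locally integrable `f`,
`S|f| ∈ Λ_φ` iff `∫₀^∞ |f|·θ_φ < ∞`, and
`∫₀^∞ |f|·θ_φ ≤ ‖S|f|‖_{Λ_φ} ≤ (1+C)·∫₀^∞ |f|·θ_φ`:
the optimal domain `[S, Λ_φ]` is the weighted space `L¹(θ_φ(t) dt)`. -/
theorem hardy_domain_eq_weighted_L1 (φ φ' : ℝ → ℝ)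
    (hmono : MonotoneOn φ (Ici 0)) (hconc : ConcaveOn ℝ (Ici 0) φ)
    (hcont : ContinuousOn φ (Ici 0)) (hφ0 : φ 0 = 0)
    (hφ'meas : Measurable φ') (hφ'nn : ∀ t ∈ Ioi (0 : ℝ), 0 ≤ φ' t)
    (hφ'anti : AntitoneOn φ' (Ioi 0))
    (hFTC : ∀ t > (0 : ℝ),
      ENNReal.ofReal (φ t) = ∫⁻ s in Ioo (0 : ℝ) t, ENNReal.ofReal (φ' s))
    (hθ : ∀ y > (0 : ℝ), theta φ' y < ⊤)
    (C : ℝ) (hC : 0 < C)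
    (hCineq : ∀ t > (0 : ℝ), ENNReal.ofReal (φ t / t) ≤ ENNReal.ofReal C * theta φ' t)
    (f : ℝ → ℝ) (hfmeas : Measurable f)
    (hfloc : ∀ x > (0 : ℝ), IntegrableOn f (Ioo 0 x)) :
    (lorentzNorm φ (fun x => S (fun y => |f y|) x) < ⊤ ↔
        (∫⁻ t in Ioi (0 : ℝ), ENNReal.ofReal |f t| * theta φ' t) < ⊤) ∧
    (∫⁻ t in Ioi (0 : ℝ), ENNReal.ofReal |f t| * theta φ' t)
        ≤ lorentzNorm φ (fun x => S (fun y => |f y|) x) ∧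
    lorentzNorm φ (fun x => S (fun y => |f y|) x)
        ≤ ENNReal.ofReal (1 + C) * ∫⁻ t in Ioi (0 : ℝ), ENNReal.ofReal |f t| * theta φ' t := by
  set F : ℝ → ℝ≥0∞ := fun y => ENNReal.ofReal |f y|
  set A : ℝ → ℝ≥0∞ := fun t => ENNReal.ofReal (φ' t)
  have hF : Measurable F := hfmeas.abs.ennreal_ofReal
  have hAm : Measurable A := hφ'meas.ennreal_ofReal
  have hA : AntitoneOn A (Ioi 0) := fun a ha b hb hab =>
    ENNReal.ofReal_le_ofReal (hφ'anti ha hb hab)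
  have hnorm : lorentzNorm φ (fun x => S (fun y => |f y|) x)
      = ∫⁻ s, ∫⁻ t, {t : ℝ | ENNReal.ofReal t < levelMeasure (hardyE F) s}.indicator A t
        ∂halfLine ∂halfLine := by
    refine setLIntegral_congr_fun measurableSet_Ioi fun s hs => ?_
    rw [distFn_eq_levelMeasure hfmeas hfloc hs, PhiE_eq_lintegral hφ0 hFTC]
  have hlower : ∫⁻ t in Ioi (0 : ℝ), ENNReal.ofReal |f t| * theta φ' t
      ≤ lorentzNorm φ (fun x => S (fun y => |f y|) x) := by
    rw [hnorm, ← lintegral_hardyE_mul hφ'meas hF,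
      lintegral_mul_eq_lintegral_levelSet (measurable_hardyE hF) hAm]
    exact lintegral_mono fun s => lintegral_indicator_le_initial hAm hA
      (measurableSet_lt measurable_const (measurable_hardyE hF))
  have hupper : lorentzNorm φ (fun x => S (fun y => |f y|) x)
      ≤ ENNReal.ofReal (1 + C) * ∫⁻ t in Ioi (0 : ℝ), ENNReal.ofReal |f t| * theta φ' t := by
    have hkm : Measurable fun q : (ℝ × ℝ) × ℝ =>
        {q : (ℝ × ℝ) × ℝ | ENNReal.ofReal q.2 < levelMeasure A q.1.1}.indicator
          (fun q => (ENNReal.ofReal q.1.2 + ENNReal.ofReal q.2)⁻¹) q := by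
      refine Measurable.indicator (by fun_prop) (measurableSet_lt (by fun_prop) ?_)
      exact (measurable_levelMeasure A).comp (by fun_prop)
    have hIm : Measurable fun p : ℝ × ℝ =>
        ∫⁻ r, {r : ℝ | ENNReal.ofReal r < levelMeasure A p.1}.indicator
          (fun r => (ENNReal.ofReal p.2 + ENNReal.ofReal r)⁻¹) r ∂halfLine :=
      hkm.lintegral_prod_right
    calc lorentzNorm φ (fun x => S (fun y => |f y|) x)
        = ∫⁻ s, ∫⁻ u, min (levelMeasure (hardyE F) s) (levelMeasure A u)
            ∂halfLine ∂halfLine := by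
          rw [hnorm]
          exact lintegral_congr fun s => lintegral_indicator_initial_eq hAm hA _
      _ = ∫⁻ u, ∫⁻ s, min (levelMeasure (hardyE F) s) (levelMeasure A u)
            ∂halfLine ∂halfLine :=
          lintegral_lintegral_swap (((measurable_levelMeasure _).comp measurable_fst).min
            ((measurable_levelMeasure _).comp measurable_snd)).aemeasurable
      _ ≤ ∫⁻ u, ∫⁻ y, F y * ∫⁻ r, {r : ℝ | ENNReal.ofReal r < levelMeasure A u}.indicator
            (fun r => (ENNReal.ofReal y + ENNReal.ofReal r)⁻¹) r ∂halfLine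
            ∂halfLine ∂halfLine :=
          lintegral_mono fun u =>
            lintegral_min_levelMeasure_hardyE_le hF (fun _ => ENNReal.ofReal_ne_top) _
      _ = ∫⁻ y, F y * ∫⁻ u, ∫⁻ r, {r : ℝ | ENNReal.ofReal r < levelMeasure A u}.indicator
            (fun r => (ENNReal.ofReal y + ENNReal.ofReal r)⁻¹) r ∂halfLine
            ∂halfLine ∂halfLine := by
          rw [lintegral_lintegral_swap ((hF.comp measurable_snd).mul hIm).aemeasurable]
          exact lintegral_congr fun y =>
            lintegral_const_mul _ (hIm.comp measurable_prodMk_right)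
      _ ≤ ∫⁻ y, ENNReal.ofReal (1 + C) * (F y * theta φ' y) ∂halfLine := by
          refine setLIntegral_mono' measurableSet_Ioi fun y hy => ?_
          rw [mul_left_comm]
          gcongr
          calc _ ≤ ∫⁻ r, A r * (ENNReal.ofReal y + ENNReal.ofReal r)⁻¹ ∂halfLine :=
                lintegral_superlevel_kernel_le hA (by fun_prop)
            _ ≤ ENNReal.ofReal (φ y / y) + theta φ' y :=
                lintegral_mul_inv_add_le hφ'meas hFTC hy
            _ ≤ ENNReal.ofReal C * theta φ' y + theta φ' y := by
                gcongr
                exact hCineq y hy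
            _ = ENNReal.ofReal (1 + C) * theta φ' y := by
                rw [ENNReal.ofReal_add zero_le_one hC.le, ENNReal.ofReal_one, add_mul, one_mul,
                  add_comm]
      _ = _ := lintegral_const_mul' _ _ ENNReal.ofReal_ne_top
  exact ⟨⟨fun h => hlower.trans_lt h,
    fun h => hupper.trans_lt (ENNReal.mul_lt_top ENNReal.ofReal_lt_top h)⟩, hlower, hupper⟩
end
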